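/- arXiv:2408.16543 — 4 statements merged into one kernel-verified Lean document; each statement's English description precedes it below -/
import Mathlib

section
/- Assume p ≪ q with dp/dq ≤ 1/μ for some 0 < μ ≤ 1 and α ≤ 1/2. Let Γ = αΣ_p + (1−α)Σ_q, let Γ̂ = αΣ_{p̂} + (1−α)Σ_{q̂} be its empirical counterpart from n i.i.d. samples of p and m i.i.d. samples of q, let β > 0, and let C(β) = sup_{x∈ℝ^d} ⟨φ(x), (Σ_p + βI)^{-1} φ(x)⟩_H. If C(β) ≤ μ(m∧n)/24, then | E[ Tr Σ_p (Γ + βI)^{-1} − Tr Σ_{p̂} (Γ̂ + βI)^{-1} ] | ≤ ( (12/(αμ)) n exp( − (m∧n)/(16 C(β)) ) + (6/μ) √(1/n + 1/m) ) C(β) + (28/(α μ²)) (1/n + 1/m) C(β)². -/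
open MeasureTheory RealInnerProductSpace
open scoped ENNReal

noncomputable section

/-- Rank-one operator `u v^*` : `f ↦ ⟪v, f⟫ • u`. -/
def rankOne {H : Type*} [NormedAddCommGroup H] [InnerProductSpace ℝ H] (u v : H) :
    H →L[ℝ] H := (innerSL ℝ v).smulRight u

/-- Covariance operator `Σ_p = ∫ φ(x) ⊗ φ(x) dp(x)`. -/
def covOp {d : ℕ} {H : Type*} [NormedAddCommGroup H] [InnerProductSpace ℝ H]
    [CompleteSpace H] (φ : EuclideanSpace ℝ (Fin d) → H)
    (p : Measure (EuclideanSpace ℝ (Fin d))) : H →L[ℝ] H :=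
  ∫ x, rankOne (φ x) (φ x) ∂p

/-- The empirical covariance operator `(1/n) ∑ᵢ φ(x_i) ⊗ φ(x_i)`. -/
def empCov {d n : ℕ} {H : Type*} [NormedAddCommGroup H] [InnerProductSpace ℝ H]
    (φ : EuclideanSpace ℝ (Fin d) → H) (xs : Fin n → EuclideanSpace ℝ (Fin d)) :
    H →L[ℝ] H :=
  (n : ℝ)⁻¹ • ∑ i, rankOne (φ (xs i)) (φ (xs i))

/-- Trace of an operator computed along a Hilbert basis. -/
def trB {H : Type*} [NormedAddCommGroup H] [InnerProductSpace ℝ H] [CompleteSpace H]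
    {ι : Type*} (b : HilbertBasis ι ℝ H) (A : H →L[ℝ] H) : ℝ :=
  ∑' i, ⟪b i, A (b i)⟫

section Aux
set_option linter.unusedSectionVars false
set_option linter.unusedVariables false
variable {X : Type*} [TopologicalSpace X] [SecondCountableTopology X] [MeasurableSpace X]
  [BorelSpace X] {H : Type*} [NormedAddCommGroup H] [InnerProductSpace ℝ H]

/-- variational lower bound for the inverse -/
lemma aux_var (G S : H →L[ℝ] H) (β : ℝ) (hβ : 0 < β)
    (hsym : ∀ u v, ⟪u, G v⟫ = ⟪v, G u⟫) (hpos : ∀ u, 0 ≤ ⟪u, G u⟫)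
    (hS : (G + β • 1) ∘L S = 1) (u w : H) :
    2 * ⟪u, w⟫ - (⟪w, G w⟫ + β * ‖w‖ ^ 2) ≤ ⟪u, S u⟫ := by
  have h1 : G (S u) + β • S u = u := by simpa using congrArg (fun T => T u) hS
  have h2 : G (S u) = u - β • S u := eq_sub_of_add_eq h1
  have h3 := hpos (S u - w)
  have h4 := hsym (S u) w
  have h5 : ⟪S u - w, S u - w⟫ = ‖S u - w‖ ^ 2 := real_inner_self_eq_norm_sq _
  have h6 := sq_nonneg ‖S u - w‖
  rw [← h5] at h6
  rw [← real_inner_self_eq_norm_sq]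
  simp only [map_sub, inner_sub_left, inner_sub_right] at h3 h6
  rw [h4, h2] at h3
  simp only [inner_sub_left, inner_sub_right, inner_smul_right] at h3
  have h7 := real_inner_comm (S u) w
  have h8 := real_inner_comm (S u) u
  have h9 := real_inner_comm w u
  nlinarith [mul_nonneg hβ.le h6]

/-- variational upper bound for `G (G + β)⁻¹` -/
lemma aux_up (G S : H →L[ℝ] H) (β : ℝ) (hβ : 0 < β)
    (hsym : ∀ u v, ⟪u, G v⟫ = ⟪v, G u⟫) (hpos : ∀ u, 0 ≤ ⟪u, G u⟫)
    (hS : (G + β • 1) ∘L S = 1) (u z : H) :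
    ⟪u, G (S u)⟫ ≤ β * ⟪z, G z⟫ + ‖u - β • z‖ ^ 2 := by
  have h1 : G (S u) + β • S u = u := by simpa using congrArg (fun T => T u) hS
  have h2 : G (S u) = u - β • S u := eq_sub_of_add_eq h1
  have h3 := mul_nonneg hβ.le (hpos (S u - z))
  have h4 := hsym (S u) z
  have h6 := sq_nonneg ‖S u - z‖
  rw [← real_inner_self_eq_norm_sq] at h6
  rw [← real_inner_self_eq_norm_sq]
  simp only [map_sub, inner_sub_left, inner_sub_right] at h3 h6
  rw [h4, h2] at h3
  rw [h2]
  simp only [inner_sub_left, inner_sub_right, inner_smul_right, real_inner_smul_left] at h3 ⊢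
  have h7 := real_inner_comm (S u) z
  have h8 := real_inner_comm (S u) u
  have h9 := real_inner_comm z u
  rw [h7] at h6 h3
  rw [h8, h9]
  nlinarith [mul_nonneg (mul_nonneg hβ.le hβ.le) h6]

lemma aux_norm (G S : H →L[ℝ] H) (β : ℝ) (hβ : 0 < β) (hpos : ∀ u, 0 ≤ ⟪u, G u⟫)
    (hS : (G + β • 1) ∘L S = 1) (u : H) : β * ‖S u‖ ≤ ‖u‖ := by
  have h1 : G (S u) + β • S u = u := by simpa using congrArg (fun T => T u) hS
  have h2 := hpos (S u)
  have h3 : ⟪S u, u⟫ = ⟪S u, G (S u)⟫ + β * ‖S u‖ ^ 2 := by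
    conv_lhs => rw [← h1]
    rw [← real_inner_self_eq_norm_sq, inner_add_right, inner_smul_right, h1]
  have h4 := real_inner_le_norm (S u) u
  rcases (norm_nonneg (S u)).eq_or_lt with h | h
  · rw [← h]; simp
  · nlinarith

lemma aux_symm (G S : H →L[ℝ] H) (β : ℝ)
    (hsym : ∀ u v, ⟪u, G v⟫ = ⟪v, G u⟫)
    (hS : (G + β • 1) ∘L S = 1) (u v : H) : ⟪u, S v⟫ = ⟪S u, v⟫ := by
  have h1 : ∀ u, G (S u) + β • S u = u := fun u => by simpa using congrArg (fun T => T u) hS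
  have h2 := hsym (S u) (S v)
  conv_lhs => rw [← h1 u]
  conv_rhs => rw [← h1 v]
  rw [inner_add_left, inner_add_right, h2, real_inner_comm, inner_smul_right, real_inner_smul_left]

lemma aux_integrable {P : Measure X} [IsFiniteMeasure P] {f : X → ℝ} (hf : Continuous f)
    (B : ℝ) (hB : ∀ x, |f x| ≤ B) : Integrable f P :=
  Integrable.of_bound hf.measurable.aestronglyMeasurable B (Filter.Eventually.of_forall hB)

variable {Ω A : Type*} [MeasurableSpace Ω] [Fintype A] [DecidableEq A]

lemma aux_g_bound (φ : X → H) (hφ1 : ∀ x, ‖φ x‖ = 1) (R : H →L[ℝ] H) (x y : X) :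
    |⟪φ x, R (φ y)⟫| ≤ ‖R‖ := by
  refine (abs_real_inner_le_norm _ _).trans ?_
  rw [hφ1, one_mul]
  simpa [hφ1] using R.le_opNorm (φ y)

lemma general_lower (P : Measure Ω) [IsProbabilityMeasure P] (Z : A → Ω → X)
    (hZ : ∀ a, Measurable (Z a)) (ν : A → Measure X) [∀ a, IsProbabilityMeasure (ν a)]
    (hlaw : ∀ a, P.map (Z a) = ν a)
    (hind : ∀ a b, a ≠ b → P.map (fun ω => (Z a ω, Z b ω)) = (ν a).prod (ν b))
    (φ : X → H) (hφc : Continuous φ) (hφ1 : ∀ x, ‖φ x‖ = 1)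
    (c : A → ℝ) (hc : ∀ a, 0 ≤ c a) (β : ℝ) (hβ : 0 < β)
    (G R : H →L[ℝ] H)
    (hG : ∀ u v, ⟪u, G v⟫ = ∑ a, c a * ∫ x, ⟪φ x, u⟫ * ⟪φ x, v⟫ ∂(ν a))
    (hR : (G + β • 1) ∘L R = 1)
    (Gh S : Ω → H →L[ℝ] H)
    (hGh : ∀ ω u v, ⟪u, Gh ω v⟫ = ∑ a, c a * (⟪φ (Z a ω), u⟫ * ⟪φ (Z a ω), v⟫))
    (hS : ∀ ω, (Gh ω + β • 1) ∘L S ω = 1)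
    (a : A) (hint : Integrable (fun ω => ⟪φ (Z a ω), S ω (φ (Z a ω))⟫) P) :
    ∫ x, ⟪φ x, R (φ x)⟫ ∂(ν a) - c a * ∫ x, ⟪φ x, R (φ x)⟫ ^ 2 ∂(ν a)
      ≤ ∫ ω, ⟪φ (Z a ω), S ω (φ (Z a ω))⟫ ∂P := by
  have hsym : ∀ ω u v, ⟪u, Gh ω v⟫ = ⟪v, Gh ω u⟫ := fun ω u v => by
    rw [hGh, hGh]; simp only [mul_comm]
  have hpos : ∀ ω u, 0 ≤ ⟪u, Gh ω u⟫ := fun ω u => by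
    rw [hGh]; exact Finset.sum_nonneg fun a _ => mul_nonneg (hc a) (mul_self_nonneg _)
  have hpt : ∀ ω, 2 * ⟪φ (Z a ω), R (φ (Z a ω))⟫ - ((∑ b, c b * ⟪φ (Z b ω), R (φ (Z a ω))⟫ ^ 2)
      + β * ‖R (φ (Z a ω))‖ ^ 2) ≤ ⟪φ (Z a ω), S ω (φ (Z a ω))⟫ := fun ω => by
    have := aux_var (Gh ω) (S ω) β hβ (hsym ω) (hpos ω) (hS ω) (φ (Z a ω)) (R (φ (Z a ω)))
    rw [hGh] at this
    simpa only [pow_two] using this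
  -- continuity / integrability
  have hB : ∀ x y, |⟪φ x, R (φ y)⟫ ^ 2| ≤ ‖R‖ ^ 2 := fun x y => by
    rw [abs_pow]; exact pow_le_pow_left₀ (abs_nonneg _) (aux_g_bound φ hφ1 R x y) 2
  have hc2 : Continuous fun z : X × X => ⟪φ z.1, R (φ z.2)⟫ ^ 2 := by fun_prop
  have hc1 : Continuous fun x : X => ⟪φ x, R (φ x)⟫ := by fun_prop
  have hc12 : Continuous fun x : X => ⟪φ x, R (φ x)⟫ ^ 2 := by fun_prop
  have hcn : Continuous fun x : X => ‖R (φ x)‖ ^ 2 := by fun_prop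
  have hnB : ∀ x, |‖R (φ x)‖ ^ 2| ≤ ‖R‖ ^ 2 := fun x => by
    rw [abs_pow, abs_norm]
    exact pow_le_pow_left₀ (norm_nonneg _) (by simpa [hφ1] using R.le_opNorm (φ x)) 2
  have i1 : Integrable (fun ω => ⟪φ (Z a ω), R (φ (Z a ω))⟫) P :=
    Integrable.of_bound (hc1.measurable.comp (hZ a)).aestronglyMeasurable ‖R‖
      (Filter.Eventually.of_forall fun ω => aux_g_bound φ hφ1 R _ _)
  have i2 : ∀ b, Integrable (fun ω => ⟪φ (Z b ω), R (φ (Z a ω))⟫ ^ 2) P := fun b =>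
    Integrable.of_bound
      (hc2.measurable.comp ((hZ b).prodMk (hZ a))).aestronglyMeasurable (‖R‖ ^ 2)
      (Filter.Eventually.of_forall fun ω => hB _ _)
  have i3 : Integrable (fun ω => ‖R (φ (Z a ω))‖ ^ 2) P :=
    Integrable.of_bound (hcn.measurable.comp (hZ a)).aestronglyMeasurable (‖R‖ ^ 2)
      (Filter.Eventually.of_forall fun ω => hnB _)
  have i4 : Integrable (fun ω => ∑ b, c b * ⟪φ (Z b ω), R (φ (Z a ω))⟫ ^ 2) P :=
    integrable_finsetSum _ fun b _ => (i2 b).const_mul _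
  have key := integral_mono ((i1.const_mul 2).sub (i4.add (i3.const_mul β))) hint hpt
  refine le_trans ?_ key
  rw [integral_sub' (i1.const_mul 2) (i4.add (i3.const_mul β)),
    integral_add' i4 (i3.const_mul β), integral_finsetSum _ fun b _ => (i2 b).const_mul _]
  simp only [integral_const_mul]
  have e1 : ∫ ω, ⟪φ (Z a ω), R (φ (Z a ω))⟫ ∂P = ∫ x, ⟪φ x, R (φ x)⟫ ∂(ν a) := by
    rw [← hlaw a, integral_map (hZ a).aemeasurable hc1.measurable.aestronglyMeasurable]
  have e3 : ∫ ω, ‖R (φ (Z a ω))‖ ^ 2 ∂P = ∫ x, ‖R (φ x)‖ ^ 2 ∂(ν a) := by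
    rw [← hlaw a, integral_map (hZ a).aemeasurable hcn.measurable.aestronglyMeasurable]
  have j2 : ∀ b, Integrable (fun z : X × X => ⟪φ z.1, R (φ z.2)⟫ ^ 2) ((ν b).prod (ν a)) :=
    fun b => aux_integrable hc2 (‖R‖ ^ 2) fun z => hB _ _
  have e2 : ∀ b, c b * ∫ ω, ⟪φ (Z b ω), R (φ (Z a ω))⟫ ^ 2 ∂P
      ≤ c b * (∫ y, ∫ x, ⟪φ x, R (φ y)⟫ ^ 2 ∂(ν b) ∂(ν a))
        + if b = a then c a * ∫ x, ⟪φ x, R (φ x)⟫ ^ 2 ∂(ν a) else 0 := fun b => by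
    split_ifs with h
    · subst h
      have : ∫ ω, ⟪φ (Z b ω), R (φ (Z b ω))⟫ ^ 2 ∂P = ∫ x, ⟪φ x, R (φ x)⟫ ^ 2 ∂(ν b) := by
        rw [← hlaw b, integral_map (hZ b).aemeasurable
          hc12.measurable.aestronglyMeasurable]
      rw [this]
      have : 0 ≤ c b * (∫ y, ∫ x, ⟪φ x, R (φ y)⟫ ^ 2 ∂(ν b) ∂(ν b)) :=
        mul_nonneg (hc b) (integral_nonneg fun y => integral_nonneg fun x => sq_nonneg _)
      linarith
    · have : ∫ ω, ⟪φ (Z b ω), R (φ (Z a ω))⟫ ^ 2 ∂P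
          = ∫ y, ∫ x, ⟪φ x, R (φ y)⟫ ^ 2 ∂(ν b) ∂(ν a) := by
        rw [← integral_prod_symm (fun z : X × X => ⟪φ z.1, R (φ z.2)⟫ ^ 2) (j2 b), ← hind b a h,
          integral_map ((hZ b).prodMk (hZ a)).aemeasurable hc2.measurable.aestronglyMeasurable]
      rw [this, add_zero]
  have e4 : ∑ b, c b * (∫ y, ∫ x, ⟪φ x, R (φ y)⟫ ^ 2 ∂(ν b) ∂(ν a))
      = ∫ x, ⟪φ x, R (φ x)⟫ ∂(ν a) - β * ∫ x, ‖R (φ x)‖ ^ 2 ∂(ν a) := by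
    have k1 : ∀ b, Integrable (fun y => ∫ x, ⟪φ x, R (φ y)⟫ ^ 2 ∂(ν b)) (ν a) := fun b =>
      (j2 b).integral_prod_right
    have k2 : ∀ b, c b * (∫ y, ∫ x, ⟪φ x, R (φ y)⟫ ^ 2 ∂(ν b) ∂(ν a))
        = ∫ y, c b * ∫ x, ⟪φ x, R (φ y)⟫ ^ 2 ∂(ν b) ∂(ν a) := fun b =>
      (integral_const_mul _ _).symm
    rw [Finset.sum_congr rfl fun b _ => k2 b, ← integral_const_mul,
      ← integral_finsetSum _ fun b _ => (k1 b).const_mul _, ← integral_sub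
      (aux_integrable hc1 ‖R‖ fun x => aux_g_bound φ hφ1 R _ _)
      ((aux_integrable hcn _ hnB).const_mul β)]
    congr 1; ext y
    have h1 : G (R (φ y)) + β • R (φ y) = φ y := by
      simpa using congrArg (fun T => T (φ y)) hR
    have h2 : G (R (φ y)) = φ y - β • R (φ y) := eq_sub_of_add_eq h1
    have h3 := hG (R (φ y)) (R (φ y))
    rw [h2, inner_sub_right, inner_smul_right, real_inner_self_eq_norm_sq, real_inner_comm] at h3
    rw [h3]
    simp only [pow_two]
  have e5 := Finset.sum_le_sum fun b (_ : b ∈ Finset.univ) => e2 b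
  rw [Finset.sum_add_distrib, e4] at e5
  simp only [Finset.sum_ite_eq', Finset.mem_univ, if_true] at e5
  rw [e1, e3]
  linarith

variable [CompleteSpace H] {ι : Type*}

lemma tr_rank (b : HilbertBasis ι ℝ H) (T : H →L[ℝ] H) (w : H) :
    HasSum (fun k => ⟪w, b k⟫ * ⟪w, T (b k)⟫) ⟪w, T w⟫ := by
  have h := b.hasSum_inner_mul_inner w (T.adjoint w)
  rw [ContinuousLinearMap.adjoint_inner_right, real_inner_comm] at h
  have e : (fun k => ⟪w, b k⟫ * ⟪w, T (b k)⟫)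
      = fun k => ⟪w, b k⟫ * ⟪b k, T.adjoint w⟫ := by
    funext k
    rw [ContinuousLinearMap.adjoint_inner_right, real_inner_comm w]
  rw [e]; exact h

lemma tr_sq (b : HilbertBasis ι ℝ H) (w : H) :
    HasSum (fun k => ⟪w, b k⟫ * ⟪w, b k⟫) (‖w‖ ^ 2) := by
  have h := tr_rank b 1 w
  simpa using h

lemma tr_int (b : HilbertBasis ι ℝ H) (φ : X → H) (hφc : Continuous φ) (hφ1 : ∀ x, ‖φ x‖ = 1)
    (ν : Measure X) [IsProbabilityMeasure ν] (T : H →L[ℝ] H) :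
    HasSum (fun k => ∫ x, ⟪φ x, b k⟫ * ⟪φ x, T (b k)⟫ ∂ν) (∫ x, ⟪φ x, T (φ x)⟫ ∂ν) := by
  obtain ⟨s, hs, hsd⟩ := TopologicalSpace.exists_countable_dense X
  set K : Set ι := ⋃ x ∈ s, Function.support (fun k => ⟪φ x, b k⟫ * ⟪φ x, b k⟫) with hK
  have hKc : K.Countable := hs.biUnion fun x _ => (tr_sq b (φ x)).summable.countable_support
  have hz : ∀ k, k ∉ K → ∀ x, ⟪φ x, b k⟫ = 0 := by
    intro k hk
    have hc : Continuous fun x => ⟪φ x, b k⟫ := by fun_prop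
    have := hc.ext_on hsd (continuous_const (y := (0:ℝ))) (fun x hx => by
      by_contra h
      exact hk (Set.mem_biUnion hx (by simpa using h)))
    exact fun x => congrFun this x
  have hsub : ∀ x, Function.support (fun k => ⟪φ x, b k⟫ * ⟪φ x, T (b k)⟫) ⊆ K := by
    intro x k hk
    by_contra h
    exact hk (by simp [hz k h x])
  have hsub' : Function.support (fun k => ∫ x, ⟪φ x, b k⟫ * ⟪φ x, T (b k)⟫ ∂ν) ⊆ K := by
    intro k hk
    by_contra h
    exact hk (by simp [hz k h])
  rw [← hasSum_subtype_iff_of_support_subset hsub']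
  have : Countable K := hKc.to_subtype
  have hbd : ∀ k x, ‖⟪φ x, b k⟫ * ⟪φ x, T (b k)⟫‖ ≤
      ⟪φ x, b k⟫ * ⟪φ x, b k⟫ + ⟪T.adjoint (φ x), b k⟫ * ⟪T.adjoint (φ x), b k⟫ := by
    intro k x
    rw [ContinuousLinearMap.adjoint_inner_left, Real.norm_eq_abs, abs_mul]
    nlinarith [sq_nonneg (|⟪φ x, b k⟫| - |⟪φ x, T (b k)⟫|), sq_abs ⟪φ x, b k⟫,
      sq_abs ⟪φ x, T (b k)⟫, sq_nonneg ⟪φ x, b k⟫, sq_nonneg ⟪φ x, T (b k)⟫]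
  have hbs : ∀ x, HasSum (fun k => ⟪φ x, b k⟫ * ⟪φ x, b k⟫
      + ⟪T.adjoint (φ x), b k⟫ * ⟪T.adjoint (φ x), b k⟫) (‖φ x‖ ^ 2 + ‖T.adjoint (φ x)‖ ^ 2) :=
    fun x => (tr_sq b (φ x)).add (tr_sq b (T.adjoint (φ x)))
  have hsumm : ∀ x, Summable (fun k : K => ‖⟪φ x, b k⟫ * ⟪φ x, T (b k)⟫‖) := fun x =>
    (Summable.of_nonneg_of_le (fun k => norm_nonneg _) (fun k => hbd k x)
      (hbs x).summable).subtype K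
  have hcont : ∀ k, Continuous fun x => ⟪φ x, b k⟫ * ⟪φ x, T (b k)⟫ := fun k => by fun_prop
  have htle : ∀ x, ∑' k : K, ‖⟪φ x, b k⟫ * ⟪φ x, T (b k)⟫‖ ≤ 1 + ‖T.adjoint‖ ^ 2 := by
    intro x
    have h0 : Summable (fun k => ‖⟪φ x, b k⟫ * ⟪φ x, T (b k)⟫‖) :=
      Summable.of_nonneg_of_le (fun k => norm_nonneg _) (fun k => hbd k x) (hbs x).summable
    have h1 : ∑' k : K, ‖⟪φ x, b k⟫ * ⟪φ x, T (b k)⟫‖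
        ≤ ∑' k, ‖⟪φ x, b k⟫ * ⟪φ x, T (b k)⟫‖ :=
      h0.tsum_subtype_le (fun k => ‖⟪φ x, b k⟫ * ⟪φ x, T (b k)⟫‖) K (fun k => norm_nonneg _)
    have h2 : ∑' k, ‖⟪φ x, b k⟫ * ⟪φ x, T (b k)⟫‖ ≤ ‖φ x‖ ^ 2 + ‖T.adjoint (φ x)‖ ^ 2 :=
      hasSum_le (fun k => hbd k x) h0.hasSum (hbs x)
    have h3 : ‖T.adjoint (φ x)‖ ^ 2 ≤ ‖T.adjoint‖ ^ 2 :=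
      pow_le_pow_left₀ (norm_nonneg _) (by simpa [hφ1] using (T.adjoint).le_opNorm (φ x)) 2
    rw [hφ1] at h2
    linarith
  refine hasSum_integral_of_dominated_convergence
    (F := fun (k : K) x => ⟪φ x, b k⟫ * ⟪φ x, T (b k)⟫)
    (fun k x => ‖⟪φ x, b k⟫ * ⟪φ x, T (b k)⟫‖)
    (fun k => (hcont k).measurable.aestronglyMeasurable)
    (fun k => Filter.Eventually.of_forall fun x => le_rfl)
    (Filter.Eventually.of_forall hsumm) ?_
    (Filter.Eventually.of_forall fun x =>
      (hasSum_subtype_iff_of_support_subset (hsub x)).2 (tr_rank b T (φ x)))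
  refine Integrable.of_bound
    (Measurable.tsum fun k : K => (hcont k).norm.measurable).aestronglyMeasurable
    (1 + ‖T.adjoint‖ ^ 2) (Filter.Eventually.of_forall fun x => ?_)
  rw [Real.norm_of_nonneg (tsum_nonneg fun k => norm_nonneg _)]
  exact htle x

lemma upper_pt (b : HilbertBasis ι ℝ H) (z : A → X) (ν : A → Measure X)
    [∀ a, IsProbabilityMeasure (ν a)]
    (φ : X → H) (hφc : Continuous φ) (hφ1 : ∀ x, ‖φ x‖ = 1)
    (c : A → ℝ) (hc : ∀ a, 0 ≤ c a) (β : ℝ) (hβ : 0 < β)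
    (G R : H →L[ℝ] H)
    (hG : ∀ u v, ⟪u, G v⟫ = ∑ a, c a * ∫ x, ⟪φ x, u⟫ * ⟪φ x, v⟫ ∂(ν a))
    (hR : (G + β • 1) ∘L R = 1)
    (Gh S : H →L[ℝ] H)
    (hGh : ∀ u v, ⟪u, Gh v⟫ = ∑ a, c a * (⟪φ (z a), u⟫ * ⟪φ (z a), v⟫))
    (hS : (Gh + β • 1) ∘L S = 1) :
    ∑ a, c a * ⟪φ (z a), S (φ (z a))⟫ ≤
      β * (∑ a, c a * ‖R (φ (z a))‖ ^ 2) +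
       (∑ a, c a * ∫ x, ⟪φ x, R (φ x)⟫ ∂(ν a) - β * ∑ a, c a * ∫ x, ‖R (φ x)‖ ^ 2 ∂(ν a)) := by
  have hsym : ∀ u v, ⟪u, Gh v⟫ = ⟪v, Gh u⟫ := fun u v => by
    rw [hGh, hGh]; simp only [mul_comm]
  have hpos : ∀ u, 0 ≤ ⟪u, Gh u⟫ := fun u => by
    rw [hGh]; exact Finset.sum_nonneg fun a _ => mul_nonneg (hc a) (mul_self_nonneg _)
  have hGsym : ∀ u v, ⟪u, G v⟫ = ⟪v, G u⟫ := fun u v => by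
    rw [hG, hG]; simp only [mul_comm]
  have hRsym := aux_symm G R β hGsym hR
  have s1 : HasSum (fun k => ∑ a, c a * (⟪φ (z a), b k⟫ * ⟪φ (z a), S (b k)⟫))
      (∑ a, c a * ⟪φ (z a), S (φ (z a))⟫) :=
    hasSum_sum fun a _ => (tr_rank b S (φ (z a))).mul_left (c a)
  have s2 : HasSum (fun k => ∑ a, c a * (⟪R (φ (z a)), b k⟫ * ⟪R (φ (z a)), b k⟫))
      (∑ a, c a * ‖R (φ (z a))‖ ^ 2) :=
    hasSum_sum fun a _ => (tr_sq b (R (φ (z a)))).mul_left (c a)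
  have s3 : HasSum (fun k => ∑ a, c a * ∫ x, ⟪φ x, b k⟫ * ⟪φ x, R (b k)⟫ ∂(ν a))
      (∑ a, c a * ∫ x, ⟪φ x, R (φ x)⟫ ∂(ν a)) :=
    hasSum_sum fun a _ => (tr_int b φ hφc hφ1 (ν a) R).mul_left (c a)
  have s4 : HasSum (fun k => ∑ a, c a * ∫ x, ⟪φ x, b k⟫ * ⟪φ x, (R ∘L R) (b k)⟫ ∂(ν a))
      (∑ a, c a * ∫ x, ⟪φ x, (R ∘L R) (φ x)⟫ ∂(ν a)) :=
    hasSum_sum fun a _ => (tr_int b φ hφc hφ1 (ν a) (R ∘L R)).mul_left (c a)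
  have e4 : ∀ x, ⟪φ x, (R ∘L R) (φ x)⟫ = ‖R (φ x)‖ ^ 2 := fun x => by
    rw [ContinuousLinearMap.comp_apply, hRsym, real_inner_self_eq_norm_sq]
  simp only [e4] at s4
  refine hasSum_le (fun k => ?_) s1 ((s2.mul_left β).add (s3.sub (s4.mul_left β)))
  have h := aux_up Gh S β hβ hsym hpos hS (b k) (R (b k))
  have hGR : ∀ u, u - β • R u = G (R u) := fun u => by
    have h1 : G (R u) + β • R u = u := by simpa using congrArg (fun T => T u) hR
    exact (eq_sub_of_add_eq h1).symm
  have h5 : ‖b k - β • R (b k)‖ ^ 2 = ⟪b k, G (R (b k))⟫ - β * ⟪b k, G ((R ∘L R) (b k))⟫ := by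
    rw [← real_inner_self_eq_norm_sq, ContinuousLinearMap.comp_apply, ← hGR, ← hGR]
    simp only [inner_sub_left, inner_sub_right, inner_smul_right, real_inner_smul_left]
    rw [hRsym (b k) (R (b k)), hRsym (b k) (b k)]
  rw [h5, hGh, hGh, hG, hG] at h
  simpa only [hRsym] using h

lemma general_upper (b : HilbertBasis ι ℝ H)
    (P : Measure Ω) [IsProbabilityMeasure P] (Z : A → Ω → X)
    (hZ : ∀ a, Measurable (Z a)) (ν : A → Measure X) [∀ a, IsProbabilityMeasure (ν a)]
    (hlaw : ∀ a, P.map (Z a) = ν a)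
    (φ : X → H) (hφc : Continuous φ) (hφ1 : ∀ x, ‖φ x‖ = 1)
    (c : A → ℝ) (hc : ∀ a, 0 ≤ c a) (β : ℝ) (hβ : 0 < β)
    (G R : H →L[ℝ] H)
    (hG : ∀ u v, ⟪u, G v⟫ = ∑ a, c a * ∫ x, ⟪φ x, u⟫ * ⟪φ x, v⟫ ∂(ν a))
    (hR : (G + β • 1) ∘L R = 1)
    (Gh S : Ω → H →L[ℝ] H)
    (hGh : ∀ ω u v, ⟪u, Gh ω v⟫ = ∑ a, c a * (⟪φ (Z a ω), u⟫ * ⟪φ (Z a ω), v⟫))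
    (hS : ∀ ω, (Gh ω + β • 1) ∘L S ω = 1)
    (hint : ∀ a, Integrable (fun ω => ⟪φ (Z a ω), S ω (φ (Z a ω))⟫) P) :
    ∑ a, c a * ∫ ω, ⟪φ (Z a ω), S ω (φ (Z a ω))⟫ ∂P
      ≤ ∑ a, c a * ∫ x, ⟪φ x, R (φ x)⟫ ∂(ν a) := by
  have hcn : Continuous fun x : X => ‖R (φ x)‖ ^ 2 := by fun_prop
  have hnB : ∀ x, |‖R (φ x)‖ ^ 2| ≤ ‖R‖ ^ 2 := fun x => by
    rw [abs_pow, abs_norm]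
    exact pow_le_pow_left₀ (norm_nonneg _) (by simpa [hφ1] using R.le_opNorm (φ x)) 2
  have i3 : ∀ a, Integrable (fun ω => ‖R (φ (Z a ω))‖ ^ 2) P := fun a =>
    Integrable.of_bound (hcn.measurable.comp (hZ a)).aestronglyMeasurable (‖R‖ ^ 2)
      (Filter.Eventually.of_forall fun ω => hnB _)
  have e3 : ∀ a, ∫ ω, ‖R (φ (Z a ω))‖ ^ 2 ∂P = ∫ x, ‖R (φ x)‖ ^ 2 ∂(ν a) := fun a => by
    rw [← hlaw a, integral_map (hZ a).aemeasurable hcn.measurable.aestronglyMeasurable]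
  have i4 : Integrable (fun ω => ∑ a, c a * ‖R (φ (Z a ω))‖ ^ 2) P :=
    integrable_finsetSum _ fun a _ => (i3 a).const_mul _
  have i5 : Integrable (fun ω => ∑ a, c a * ⟪φ (Z a ω), S ω (φ (Z a ω))⟫) P :=
    integrable_finsetSum _ fun a _ => (hint a).const_mul _
  have key := integral_mono i5 ((i4.const_mul β).add (integrable_const _)) (fun ω =>
    upper_pt b (fun a => Z a ω) ν φ hφc hφ1 c hc β hβ G R hG hR (Gh ω) (S ω) (hGh ω) (hS ω))
  rw [integral_add' (i4.const_mul β) (integrable_const _), integral_const_mul,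
    integral_finsetSum _ fun a _ => (hint a).const_mul _,
    integral_finsetSum _ fun a _ => (i3 a).const_mul _] at key
  simp only [integral_const_mul, e3, integral_const, probReal_univ, one_smul] at key
  linarith

lemma pi_pair {ι' : Type*} [Fintype ι'] (p : Measure X) [IsProbabilityMeasure p] (i j : ι')
    (h : i ≠ j) : (Measure.pi fun _ : ι' => p).map (fun x => (x i, x j)) = p.prod p := by
  have h1 := (ProbabilityTheory.iIndepFun_pi (μ := fun _ : ι' => p) (X := fun _ x => x)
    (fun i => aemeasurable_id)).indepFun h
  rw [ProbabilityTheory.indepFun_iff_map_prod_eq_prod_map_map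
    (measurable_pi_apply i).aemeasurable (measurable_pi_apply j).aemeasurable] at h1
  rw [h1]
  have e : ∀ i, (Measure.pi fun _ : ι' => p).map (fun x => x i) = p := fun i =>
    (measurePreserving_eval (fun _ : ι' => p) i).map_eq
  rw [e, e]

end Aux

section Aux2
variable {d : ℕ} {H : Type*} [NormedAddCommGroup H] [InnerProductSpace ℝ H] [CompleteSpace H]

lemma covOp_inner (φ : EuclideanSpace ℝ (Fin d) → H) (hφc : Continuous φ) (hφ1 : ∀ x, ‖φ x‖ = 1)
    (p : Measure (EuclideanSpace ℝ (Fin d))) [IsProbabilityMeasure p] (u v : H) :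
    ⟪u, covOp φ p v⟫ = ∫ x, ⟪φ x, u⟫ * ⟪φ x, v⟫ ∂p := by
  have hcont : Continuous fun x => rankOne (φ x) (φ x) := by
    have h1 : Continuous fun x => innerSL ℝ (φ x) := (innerSL ℝ).continuous.comp hφc
    have h2 : Continuous fun x => ContinuousLinearMap.smulRightL ℝ H H (innerSL ℝ (φ x)) :=
      (ContinuousLinearMap.smulRightL ℝ H H).continuous.comp h1
    exact h2.clm_apply hφc
  have hi : Integrable (fun x => rankOne (φ x) (φ x)) p := by
    refine Integrable.of_bound hcont.aestronglyMeasurable 1 (Filter.Eventually.of_forall fun x => ?_)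
    simp [rankOne, ContinuousLinearMap.norm_smulRight_apply, hφ1]
  unfold covOp
  rw [ContinuousLinearMap.integral_apply hi, ← integral_inner (hi.apply_continuousLinearMap v)]
  congr 1; ext x
  simp [rankOne, inner_smul_right, real_inner_comm, mul_comm]

lemma empCov_inner {n : ℕ} (φ : EuclideanSpace ℝ (Fin d) → H)
    (xs : Fin n → EuclideanSpace ℝ (Fin d)) (u v : H) :
    ⟪u, empCov φ xs v⟫ = ∑ i, (n : ℝ)⁻¹ * (⟪φ (xs i), u⟫ * ⟪φ (xs i), v⟫) := by
  unfold empCov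
  rw [_root_.smul_apply, inner_smul_right, _root_.sum_apply, inner_sum,
    Finset.mul_sum]
  refine Finset.sum_congr rfl fun i _ => ?_
  simp [rankOne, inner_smul_right, real_inner_comm, mul_comm]

lemma empCov_cont {n : ℕ} (φ : EuclideanSpace ℝ (Fin d) → H) (hφc : Continuous φ) :
    Continuous fun xs : Fin n → EuclideanSpace ℝ (Fin d) => empCov φ xs := by
  have hcont : Continuous fun x => rankOne (φ x) (φ x) := by
    have h1 : Continuous fun x => innerSL ℝ (φ x) := (innerSL ℝ).continuous.comp hφc
    have h2 : Continuous fun x => ContinuousLinearMap.smulRightL ℝ H H (innerSL ℝ (φ x)) :=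
      (ContinuousLinearMap.smulRightL ℝ H H).continuous.comp h1
    exact h2.clm_apply hφc
  unfold empCov
  exact (continuous_finsetSum _ fun i _ => hcont.comp (continuous_apply i)).const_smul ((n : ℝ)⁻¹)

lemma inv_cont {Y : Type*} [TopologicalSpace Y] (T S : Y → H →L[ℝ] H) (hT : Continuous T)
    (h1 : ∀ y, S y ∘L T y = 1) (h2 : ∀ y, T y ∘L S y = 1) : Continuous S := by
  have e : S = fun y => Ring.inverse (T y) := by
    funext y
    exact (Ring.inverse_unit (⟨T y, S y, h2 y, h1 y⟩ : (H →L[ℝ] H)ˣ)).symm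
  rw [e, continuous_iff_continuousAt]
  intro y
  exact ContinuousAt.comp (f := T)
    (NormedRing.inverse_continuousAt (⟨T y, S y, h2 y, h1 y⟩ : (H →L[ℝ] H)ˣ)) hT.continuousAt

lemma dom_int {X : Type*} [MeasurableSpace X] (p q : Measure X) [IsProbabilityMeasure p]
    [IsProbabilityMeasure q] (μ : ℝ) (hμ : 0 < μ) (hpq : p ≪ q)
    (hratio : ∀ᵐ x ∂q, p.rnDeriv q x ≤ ENNReal.ofReal (1 / μ)) (f : X → ℝ) (hf : ∀ x, 0 ≤ f x)
    (hi : Integrable f q) : μ * ∫ x, f x ∂p ≤ ∫ x, f x ∂q := by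
  have hle : p ≤ ENNReal.ofReal (1 / μ) • q := by
    rw [← Measure.withDensity_rnDeriv_eq p q hpq, ← withDensity_const]
    exact withDensity_mono hratio
  have h := integral_mono_measure hle (Filter.Eventually.of_forall hf)
    (hi.smul_measure ENNReal.ofReal_ne_top)
  rw [integral_smul_measure, ENNReal.toReal_ofReal (by positivity), smul_eq_mul] at h
  have := mul_le_mul_of_nonneg_left h hμ.le
  rwa [← mul_assoc, mul_one_div_cancel hμ.ne', one_mul] at this

end Aux2

set_option maxHeartbeats 2000000

/-- **Estimation of skewed degrees of freedom.**  With `Γ = αΣ_p + (1-α)Σ_q`, `Γ̂` its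
empirical counterpart, `R = (Γ+βI)⁻¹` and `R̂ = (Γ̂+βI)⁻¹`, and
`C = C(β) = sup_x ⟪φ(x), (Σ_p+βI)⁻¹ φ(x)⟫ ≤ μ(m∧n)/24`,
`|E[Tr Σ_p (Γ+βI)⁻¹ - Tr Σ_{p̂} (Γ̂+βI)⁻¹]|
  ≤ ((12/(αμ)) n e^{-(m∧n)/(16C)} + (6/μ)√(1/n+1/m)) C + (28/(αμ²))(1/n+1/m) C²`. -/
theorem skewed_degrees_of_freedom {d n m : ℕ} (hn : 0 < n) (hm : 0 < m)
    {H : Type*} [NormedAddCommGroup H] [InnerProductSpace ℝ H] [CompleteSpace H]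
    {ι : Type*} (b : HilbertBasis ι ℝ H)
    (k : EuclideanSpace ℝ (Fin d) → EuclideanSpace ℝ (Fin d) → ℝ)
    (φ : EuclideanSpace ℝ (Fin d) → H) (hφc : Continuous φ)
    (hk : ∀ x y, k x y = ⟪φ x, φ y⟫) (hk1 : ∀ x, k x x = 1)
    (p q : Measure (EuclideanSpace ℝ (Fin d)))
    [IsProbabilityMeasure p] [IsProbabilityMeasure q]
    (μ α : ℝ) (hμ : 0 < μ) (hμ1 : μ ≤ 1) (hα : 0 < α) (hα2 : α ≤ 1 / 2)
    (hpq : p ≪ q) (hratio : ∀ᵐ x ∂q, p.rnDeriv q x ≤ ENNReal.ofReal (1 / μ))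
    (β : ℝ) (hβ : 0 < β)
    -- `R = (Γ + βI)⁻¹` where `Γ = αΣ_p + (1-α)Σ_q`:
    (R : H →L[ℝ] H)
    (hR : R ∘L ((α • covOp φ p + (1 - α) • covOp φ q) + β • 1) = 1)
    (hR' : ((α • covOp φ p + (1 - α) • covOp φ q) + β • 1) ∘L R = 1)
    -- `R̂ xs ys = (Γ̂ + βI)⁻¹` where `Γ̂ = αΣ_{p̂} + (1-α)Σ_{q̂}`:
    (Rhat : (Fin n → EuclideanSpace ℝ (Fin d)) → (Fin m → EuclideanSpace ℝ (Fin d)) →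
      H →L[ℝ] H)
    (hRhat : ∀ xs ys,
      Rhat xs ys ∘L ((α • empCov φ xs + (1 - α) • empCov φ ys) + β • 1) = 1 ∧
      ((α • empCov φ xs + (1 - α) • empCov φ ys) + β • 1) ∘L Rhat xs ys = 1)
    -- `C = C(β)`, via the resolvent `Rp = (Σ_p + βI)⁻¹`:
    (Rp : H →L[ℝ] H) (hRp : Rp ∘L (covOp φ p + β • 1) = 1)
    (hRp' : (covOp φ p + β • 1) ∘L Rp = 1)
    (C : ℝ) (hC : C = ⨆ x : EuclideanSpace ℝ (Fin d), ⟪φ x, Rp (φ x)⟫)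
    (hCsmall : C ≤ μ * (min m n : ℕ) / 24) :
    |∫ ω : (Fin n → EuclideanSpace ℝ (Fin d)) × (Fin m → EuclideanSpace ℝ (Fin d)),
        (trB b (covOp φ p ∘L R) - trB b (empCov φ ω.1 ∘L Rhat ω.1 ω.2))
        ∂((Measure.pi fun _ : Fin n => p).prod (Measure.pi fun _ : Fin m => q))|
      ≤ ((12 / (α * μ)) * n * Real.exp (-((min m n : ℕ) / (16 * C)))
            + (6 / μ) * Real.sqrt (1 / n + 1 / m)) * C
        + (28 / (α * μ ^ 2)) * (1 / n + 1 / m) * C ^ 2 := by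
  have hφ1 : ∀ x, ‖φ x‖ = 1 := fun x => by
    have h := hk x x
    rw [hk1, real_inner_self_eq_norm_sq] at h
    have h0 := norm_nonneg (φ x)
    nlinarith
  have hn' : (0 : ℝ) < n := Nat.cast_pos.2 hn
  have hm' : (0 : ℝ) < m := Nat.cast_pos.2 hm
  have hα1 : 0 ≤ 1 - α := by linarith
  -- the population quadratic forms
  have hcov := fun u v => covOp_inner φ hφc hφ1 p u v
  have hcovq := fun u v => covOp_inner φ hφc hφ1 q u v
  have hcpos : ∀ u, 0 ≤ ⟪u, covOp φ p u⟫ := fun u => by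
    rw [hcov]; exact integral_nonneg fun x => mul_self_nonneg _
  have hcsym : ∀ u v, ⟪u, covOp φ p v⟫ = ⟪v, covOp φ p u⟫ := fun u v => by
    rw [hcov, hcov]; simp only [mul_comm]
  have hdom : ∀ u, μ * ⟪u, covOp φ p u⟫ ≤ ⟪u, covOp φ q u⟫ := fun u => by
    rw [hcov, hcovq]
    refine dom_int p q μ hμ hpq hratio _ (fun x => mul_self_nonneg _) ?_
    refine aux_integrable (by fun_prop) (‖u‖ * ‖u‖) fun x => ?_
    rw [abs_mul]
    have : |⟪φ x, u⟫| ≤ ‖u‖ := by simpa [hφ1] using abs_real_inner_le_norm (φ x) u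
    exact mul_le_mul this this (abs_nonneg _) (norm_nonneg _)
  set G : H →L[ℝ] H := α • covOp φ p + (1 - α) • covOp φ q with hGdef
  have hGin : ∀ u v, ⟪u, G v⟫ = α * ⟪u, covOp φ p v⟫ + (1 - α) * ⟪u, covOp φ q v⟫ := fun u v => by
    simp [hGdef, inner_add_right, inner_smul_right]
  have hGp : ∀ u, μ * ⟪u, covOp φ p u⟫ ≤ ⟪u, G u⟫ := fun u => by
    rw [hGin]
    nlinarith [hdom u, hcpos u, mul_le_mul_of_nonneg_left (hdom u) hα1,
      mul_nonneg hα.le (mul_nonneg (sub_nonneg.2 hμ1) (hcpos u))]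
  have hGpos : ∀ u, 0 ≤ ⟪u, G u⟫ := fun u => (mul_nonneg hμ.le (hcpos u)).trans (hGp u)
  have hGsym : ∀ u v, ⟪u, G v⟫ = ⟪v, G u⟫ := fun u v => by
    rw [hGin, hGin, hcov, hcov, hcovq, hcovq]; simp only [mul_comm]
  -- bound on the leverage
  have hr0 : ∀ x, 0 ≤ ⟪φ x, R (φ x)⟫ := fun x => by
    simpa using aux_var G R β hβ hGsym hGpos hR' (φ x) 0
  have hCx : ∀ x, ⟪φ x, Rp (φ x)⟫ ≤ C := fun x => by
    rw [hC]
    refine le_ciSup (f := fun x => ⟪φ x, Rp (φ x)⟫) ⟨‖Rp‖, ?_⟩ x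
    rintro _ ⟨y, rfl⟩
    exact (le_abs_self _).trans (aux_g_bound φ hφ1 Rp y y)
  have hC0 : 0 ≤ C := by
    refine le_trans ?_ (hCx 0)
    simpa using aux_var (covOp φ p) Rp β hβ hcsym hcpos hRp' (φ 0) 0
  have hrC : ∀ x, ⟪φ x, R (φ x)⟫ ≤ C / μ := fun x => by
    rw [le_div_iff₀ hμ]
    refine le_trans ?_ (hCx x)
    have h := aux_var (covOp φ p) Rp β hβ hcsym hcpos hRp' (φ x) (μ • R (φ x))
    have h1 : G (R (φ x)) + β • R (φ x) = φ x := by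
      simpa using congrArg (fun T => T (φ x)) hR'
    have h2 : ⟪R (φ x), G (R (φ x))⟫ + β * ‖R (φ x)‖ ^ 2 = ⟪φ x, R (φ x)⟫ := by
      rw [← real_inner_self_eq_norm_sq, ← inner_smul_right, ← inner_add_right, h1,
        real_inner_comm]
    have h3 := mul_le_mul_of_nonneg_left (hGp (R (φ x))) hμ.le
    rw [map_smul, inner_smul_right, inner_smul_right, real_inner_smul_left, norm_smul,
      Real.norm_of_nonneg hμ.le] at h
    have h4 : 0 ≤ μ * (1 - μ) * (β * ‖R (φ x)‖ ^ 2) :=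
      mul_nonneg (mul_nonneg hμ.le (sub_nonneg.2 hμ1)) (by positivity)
    have h5 := congrArg (fun t => μ * t) h2
    nlinarith
  -- set up the joint sample
  set P := (Measure.pi fun _ : Fin n => p).prod (Measure.pi fun _ : Fin m => q) with hP
  let Z : Fin n ⊕ Fin m → ((Fin n → EuclideanSpace ℝ (Fin d)) × (Fin m → EuclideanSpace ℝ (Fin d)))
      → EuclideanSpace ℝ (Fin d) := fun a ω => Sum.elim ω.1 ω.2 a
  let ν : Fin n ⊕ Fin m → Measure (EuclideanSpace ℝ (Fin d)) := Sum.elim (fun _ => p) (fun _ => q)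
  let c : Fin n ⊕ Fin m → ℝ := Sum.elim (fun _ => α * (n : ℝ)⁻¹) (fun _ => (1 - α) * (m : ℝ)⁻¹)
  have hν : ∀ a, IsProbabilityMeasure (ν a) := by
    rintro (i | j)
    · exact ‹IsProbabilityMeasure p›
    · exact ‹IsProbabilityMeasure q›
  have hZc : ∀ a, Continuous (Z a) := by
    rintro (i | j)
    · exact (continuous_apply i).comp continuous_fst
    · exact (continuous_apply j).comp continuous_snd
  have hZ : ∀ a, Measurable (Z a) := fun a => (hZc a).measurable
  have hc0 : ∀ a, 0 ≤ c a := by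
    rintro (i | j)
    · exact mul_nonneg hα.le (inv_nonneg.2 hn'.le)
    · exact mul_nonneg hα1 (inv_nonneg.2 hm'.le)
  have ep : ∀ i, (Measure.pi fun _ : Fin n => p).map (fun x => x i) = p := fun i =>
    (measurePreserving_eval (fun _ : Fin n => p) i).map_eq
  have eq : ∀ i, (Measure.pi fun _ : Fin m => q).map (fun x => x i) = q := fun i =>
    (measurePreserving_eval (fun _ : Fin m => q) i).map_eq
  have ef : P.map Prod.fst = Measure.pi fun _ : Fin n => p := measurePreserving_fst.map_eq
  have es : P.map Prod.snd = Measure.pi fun _ : Fin m => q := measurePreserving_snd.map_eq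
  have hlaw : ∀ a, P.map (Z a) = ν a := by
    rintro (i | j)
    · change P.map ((fun x => x i) ∘ Prod.fst) = p
      rw [← Measure.map_map (measurable_pi_apply i) measurable_fst, ef, ep]
    · change P.map ((fun x => x j) ∘ Prod.snd) = q
      rw [← Measure.map_map (measurable_pi_apply j) measurable_snd, es, eq]
  have hind : ∀ a a', a ≠ a' → P.map (fun ω => (Z a ω, Z a' ω)) = (ν a).prod (ν a') := by
    rintro (i | i) (j | j) hij
    · change P.map ((fun x => (x i, x j)) ∘ Prod.fst) = p.prod p
      rw [← Measure.map_map (by fun_prop) measurable_fst, ef,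
        pi_pair p i j (fun h => hij (by rw [h]))]
    · change P.map (Prod.map (fun x => x i) (fun x => x j)) = p.prod q
      rw [hP, ← Measure.map_prod_map _ _ (measurable_pi_apply i) (measurable_pi_apply j), ep, eq]
    · have hm1 : Measurable (Prod.map (fun x : Fin n → EuclideanSpace ℝ (Fin d) => x j)
          (fun x : Fin m → EuclideanSpace ℝ (Fin d) => x i)) :=
        (measurable_pi_apply j).prodMap (measurable_pi_apply i)
      have h1 : P.map (Prod.map (fun x => x j) (fun x => x i)) = p.prod q := by
        rw [hP, ← Measure.map_prod_map _ _ (measurable_pi_apply j) (measurable_pi_apply i), ep, eq]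
      have h2 := Measure.map_map (μ := P) measurable_swap hm1
      rw [h1, Measure.prod_swap] at h2
      exact h2.symm
    · change P.map ((fun x => (x i, x j)) ∘ Prod.snd) = q.prod q
      rw [← Measure.map_map (by fun_prop) measurable_snd, es,
        pi_pair q i j (fun h => hij (by rw [h]))]
  let Gh : ((Fin n → EuclideanSpace ℝ (Fin d)) × (Fin m → EuclideanSpace ℝ (Fin d))) → H →L[ℝ] H :=
    fun ω => α • empCov φ ω.1 + (1 - α) • empCov φ ω.2
  let S : ((Fin n → EuclideanSpace ℝ (Fin d)) × (Fin m → EuclideanSpace ℝ (Fin d))) → H →L[ℝ] H :=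
    fun ω => Rhat ω.1 ω.2
  have hS1 : ∀ ω, S ω ∘L (Gh ω + β • 1) = 1 := fun ω => (hRhat ω.1 ω.2).1
  have hS2 : ∀ ω, (Gh ω + β • 1) ∘L S ω = 1 := fun ω => (hRhat ω.1 ω.2).2
  have hGhc : Continuous Gh :=
    (((empCov_cont φ hφc).comp continuous_fst).const_smul α).add
      (((empCov_cont φ hφc).comp continuous_snd).const_smul (1 - α))
  have hSc : Continuous S := inv_cont (fun ω => Gh ω + β • 1) S (hGhc.add continuous_const) hS1 hS2
  have hGh : ∀ ω u v, ⟪u, Gh ω v⟫ = ∑ a, c a * (⟪φ (Z a ω), u⟫ * ⟪φ (Z a ω), v⟫) := by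
    intro ω u v
    simp only [Gh, c, Z, Fintype.sum_sum_type, Sum.elim_inl, Sum.elim_inr]
    rw [_root_.add_apply, _root_.smul_apply, _root_.smul_apply, inner_add_right, inner_smul_right,
      inner_smul_right, empCov_inner, empCov_inner, Finset.mul_sum, Finset.mul_sum]
    simp only [mul_assoc]
  have hsumn : ∀ t : ℝ, ∑ _i : Fin n, α * (n : ℝ)⁻¹ * t = α * t := fun t => by
    rw [Finset.sum_const, Finset.card_univ, Fintype.card_fin, nsmul_eq_mul]
    field_simp
  have hsumm : ∀ t : ℝ, ∑ _i : Fin m, (1 - α) * (m : ℝ)⁻¹ * t = (1 - α) * t := fun t => by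
    rw [Finset.sum_const, Finset.card_univ, Fintype.card_fin, nsmul_eq_mul]
    field_simp
  have hG : ∀ u v, ⟪u, G v⟫ = ∑ a, c a * ∫ x, ⟪φ x, u⟫ * ⟪φ x, v⟫ ∂(ν a) := by
    intro u v
    simp only [c, ν, Fintype.sum_sum_type, Sum.elim_inl, Sum.elim_inr]
    rw [hsumn, hsumm, hGin, hcov, hcovq]
  have hGhpos : ∀ ω u, 0 ≤ ⟪u, Gh ω u⟫ := fun ω u => by
    rw [hGh]; exact Finset.sum_nonneg fun a _ => mul_nonneg (hc0 a) (mul_self_nonneg _)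
  have hint : ∀ a, Integrable (fun ω => ⟪φ (Z a ω), S ω (φ (Z a ω))⟫) P := fun a => by
    have hf : Continuous fun ω => φ (Z a ω) := hφc.comp (hZc a)
    refine aux_integrable (hf.inner (hSc.clm_apply hf)) (1 / β) fun ω => ?_
    refine (abs_real_inner_le_norm _ _).trans ?_
    rw [hφ1, one_mul, le_div_iff₀ hβ, mul_comm]
    simpa [hφ1] using aux_norm (Gh ω) (S ω) β hβ (hGhpos ω) (hS2 ω) (φ (Z a ω))
  have hlow := fun a => general_lower P Z hZ ν hlaw hind φ hφc hφ1 c hc0 β hβ G R hG hR' Gh S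
    hGh hS2 a (hint a)
  have hup := general_upper b P Z hZ ν hlaw φ hφc hφ1 c hc0 β hβ G R hG hR' Gh S hGh hS2 hint
  -- square bound
  have hsq : ∀ a, ∫ x, ⟪φ x, R (φ x)⟫ ^ 2 ∂(ν a) ≤ (C / μ) ^ 2 := fun a => by
    have h := integral_mono (μ := ν a)
      (aux_integrable (f := fun x => ⟪φ x, R (φ x)⟫ ^ 2) (by fun_prop) ((C / μ) ^ 2) fun x => by
        rw [abs_of_nonneg (sq_nonneg _)]
        exact pow_le_pow_left₀ (hr0 x) (hrC x) 2)
      (integrable_const ((C / μ) ^ 2)) (fun x => pow_le_pow_left₀ (hr0 x) (hrC x) 2)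
    simpa using h
  have hlow' : ∀ a, ∫ x, ⟪φ x, R (φ x)⟫ ∂(ν a) - c a * (C / μ) ^ 2
      ≤ ∫ ω, ⟪φ (Z a ω), S ω (φ (Z a ω))⟫ ∂P := fun a => by
    have := mul_le_mul_of_nonneg_left (hsq a) (hc0 a)
    linarith [hlow a]
  -- traces
  have tr1 : trB b (covOp φ p ∘L R) = ∫ x, ⟪φ x, R (φ x)⟫ ∂p := by
    unfold trB
    simp only [ContinuousLinearMap.comp_apply, hcov]
    exact (tr_int b φ hφc hφ1 p R).tsum_eq
  have tr2 : ∀ ω : (Fin n → EuclideanSpace ℝ (Fin d)) × (Fin m → EuclideanSpace ℝ (Fin d)),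
      trB b (empCov φ ω.1 ∘L Rhat ω.1 ω.2)
      = ∑ i : Fin n, (n : ℝ)⁻¹ * ⟪φ (Z (Sum.inl i) ω), S ω (φ (Z (Sum.inl i) ω))⟫ := fun ω => by
    unfold trB
    simp only [ContinuousLinearMap.comp_apply, empCov_inner]
    exact (hasSum_sum fun i _ => (tr_rank b (Rhat ω.1 ω.2) (φ (ω.1 i))).mul_left
      ((n : ℝ)⁻¹)).tsum_eq
  simp only [tr1, tr2]
  rw [integral_sub (integrable_const _)
    (integrable_finsetSum _ fun i _ => (hint (Sum.inl i)).const_mul _),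
    integral_finsetSum _ fun i _ => (hint (Sum.inl i)).const_mul _]
  simp only [integral_const_mul, integral_const, probReal_univ, one_smul]
  set tp := ∫ x, ⟪φ x, R (φ x)⟫ ∂p with htp
  set tq := ∫ x, ⟪φ x, R (φ x)⟫ ∂q with htq
  set Ep := ∑ i : Fin n, (n : ℝ)⁻¹ * ∫ ω, ⟪φ (Z (Sum.inl i) ω), S ω (φ (Z (Sum.inl i) ω))⟫ ∂P
    with hEp
  set Eq := ∑ i : Fin m, (m : ℝ)⁻¹ * ∫ ω, ⟪φ (Z (Sum.inr i) ω), S ω (φ (Z (Sum.inr i) ω))⟫ ∂P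
    with hEq
  have f1 : tp - α * (n : ℝ)⁻¹ * (C / μ) ^ 2 ≤ Ep := by
    have h : ∑ i : Fin n, (n : ℝ)⁻¹ * (tp - α * (n : ℝ)⁻¹ * (C / μ) ^ 2) ≤ Ep :=
      Finset.sum_le_sum fun i _ =>
        mul_le_mul_of_nonneg_left (hlow' (Sum.inl i)) (inv_nonneg.2 hn'.le)
    rwa [Finset.sum_const, Finset.card_univ, Fintype.card_fin, nsmul_eq_mul, ← mul_assoc,
      mul_inv_cancel₀ hn'.ne', one_mul] at h
  have f2 : tq - (1 - α) * (m : ℝ)⁻¹ * (C / μ) ^ 2 ≤ Eq := by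
    have h : ∑ i : Fin m, (m : ℝ)⁻¹ * (tq - (1 - α) * (m : ℝ)⁻¹ * (C / μ) ^ 2) ≤ Eq :=
      Finset.sum_le_sum fun i _ =>
        mul_le_mul_of_nonneg_left (hlow' (Sum.inr i)) (inv_nonneg.2 hm'.le)
    rwa [Finset.sum_const, Finset.card_univ, Fintype.card_fin, nsmul_eq_mul, ← mul_assoc,
      mul_inv_cancel₀ hm'.ne', one_mul] at h
  have f3 : α * Ep + (1 - α) * Eq ≤ α * tp + (1 - α) * tq := by
    simp only [c, ν, Fintype.sum_sum_type, Sum.elim_inl, Sum.elim_inr] at hup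
    rw [hsumn, hsumm] at hup
    simp only [mul_assoc, ← Finset.mul_sum] at hup
    rw [hEp, hEq]
    simp only [← Finset.mul_sum]
    exact hup
  -- conclusion
  set D := (C / μ) ^ 2 with hD
  have hD0 : 0 ≤ D := sq_nonneg _
  have hni : 0 ≤ (n : ℝ)⁻¹ := inv_nonneg.2 hn'.le
  have hmi : 0 ≤ (m : ℝ)⁻¹ := inv_nonneg.2 hm'.le
  have hai : 0 < α⁻¹ := inv_pos.2 hα
  have hai1 : 1 ≤ α⁻¹ := (one_le_inv₀ hα).2 (by linarith)
  have hfinal : |tp - Ep| ≤ α⁻¹ * ((n : ℝ)⁻¹ + (m : ℝ)⁻¹) * D := by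
    rw [abs_le]
    constructor
    · have g1 : α * (Ep - tp) ≤ (m : ℝ)⁻¹ * D := by
        have g2 := mul_le_mul_of_nonneg_left f2 hα1
        have g3 : (1 - α) * (1 - α) * ((m : ℝ)⁻¹ * D) ≤ 1 * ((m : ℝ)⁻¹ * D) :=
          mul_le_mul_of_nonneg_right (by nlinarith) (mul_nonneg hmi hD0)
        nlinarith
      have g4 := mul_le_mul_of_nonneg_left g1 hai.le
      rw [← mul_assoc, inv_mul_cancel₀ hα.ne', one_mul] at g4
      have g5 : 0 ≤ α⁻¹ * ((n : ℝ)⁻¹ * D) := mul_nonneg hai.le (mul_nonneg hni hD0)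
      nlinarith
    · have g1 : α * ((n : ℝ)⁻¹ * D) ≤ α⁻¹ * ((n : ℝ)⁻¹ * D) :=
        mul_le_mul_of_nonneg_right (by linarith) (mul_nonneg hni hD0)
      have g5 : 0 ≤ α⁻¹ * ((m : ℝ)⁻¹ * D) := mul_nonneg hai.le (mul_nonneg hmi hD0)
      nlinarith
  refine hfinal.trans ?_
  have hlead : 0 ≤ ((12 / (α * μ)) * n * Real.exp (-((min m n : ℕ) / (16 * C)))
            + (6 / μ) * Real.sqrt (1 / n + 1 / m)) * C := by positivity
  have hlast : α⁻¹ * ((n : ℝ)⁻¹ + (m : ℝ)⁻¹) * D ≤ (28 / (α * μ ^ 2)) * (1 / n + 1 / m) * C ^ 2 := by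
    have e1 : (28 / (α * μ ^ 2)) * (1 / n + 1 / m) * C ^ 2
        = 28 * (α⁻¹ * ((n : ℝ)⁻¹ + (m : ℝ)⁻¹) * D) := by
      rw [hD]; field_simp
    have e2 : 0 ≤ α⁻¹ * ((n : ℝ)⁻¹ + (m : ℝ)⁻¹) * D := by positivity
    linarith
  linarith
end
end

section
/- Let ψ be a real r×d matrix such that the r×r matrix ψψᵀ is invertible, and let g : [0,∞) → ℝ be a function with g(0) = 0 (functions of positive semi-definite matrices being defined via the spectral functional calculus). Then g(ψᵀψ) = ψᵀ (ψψᵀ)^{-1/2} g(ψψᵀ) (ψψᵀ)^{-1/2} ψ. -/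
open Matrix

noncomputable section

/-- Spectral functional calculus for real symmetric matrices: `matFun g M` applies `g`
to the eigenvalues of `M` (and returns `0` if `M` is not symmetric). -/
def matFun {N : Type*} [Fintype N] [DecidableEq N] (g : ℝ → ℝ) (M : Matrix N N ℝ) :
    Matrix N N ℝ :=
  if h : M.IsHermitian then
    (h.eigenvectorUnitary : Matrix N N ℝ) * Matrix.diagonal (g ∘ h.eigenvalues) *
      star (h.eigenvectorUnitary : Matrix N N ℝ)
  else 0

theorem matFun_mul_aux {N : Type*} [Fintype N] [DecidableEq N] (f g : ℝ → ℝ)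
    {M : Matrix N N ℝ} (h : M.IsHermitian) :
    matFun f M * matFun g M = matFun (fun t => f t * g t) M := by
  have hU : star (h.eigenvectorUnitary : Matrix N N ℝ) * (h.eigenvectorUnitary : Matrix N N ℝ) = 1 :=
    Unitary.coe_star_mul_self _
  simp only [matFun, dif_pos h]
  generalize (h.eigenvectorUnitary : Matrix N N ℝ) = U at *
  calc _ = U * diagonal (f ∘ h.eigenvalues) * (star U * U) * diagonal (g ∘ h.eigenvalues) * star U := by
        simp only [Matrix.mul_assoc]
    _ = _ := by
        rw [hU, Matrix.mul_one, Matrix.mul_assoc U, diagonal_mul_diagonal]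
        rfl

theorem matFun_id_aux {N : Type*} [Fintype N] [DecidableEq N]
    {M : Matrix N N ℝ} (h : M.IsHermitian) : matFun (fun t => t) M = M := by
  simp only [matFun, dif_pos h]
  conv_rhs => rw [h.spectral_theorem]
  simp [Unitary.conjStarAlgAut_apply]
  rfl

theorem matFun_congr_aux {N : Type*} [Fintype N] [DecidableEq N] {f g : ℝ → ℝ}
    {M : Matrix N N ℝ} (h : M.PosSemidef) (hfg : ∀ t, 0 ≤ t → f t = g t) :
    matFun f M = matFun g M := by
  simp only [matFun, dif_pos h.1]
  congr 3
  funext i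
  exact hfg _ (h.eigenvalues_nonneg i)

theorem matFun_intertwine_aux {N K : Type*} [Fintype N] [DecidableEq N] [Fintype K]
    [DecidableEq K] (f : ℝ → ℝ) {A : Matrix N N ℝ} {B : Matrix K K ℝ} (hA : A.IsHermitian)
    (hB : B.IsHermitian) (X : Matrix N K ℝ) (hX : A * X = X * B) :
    matFun f A * X = X * matFun f B := by
  have hU : star (hA.eigenvectorUnitary : Matrix N N ℝ) * (hA.eigenvectorUnitary : Matrix N N ℝ) = 1 :=
    Unitary.coe_star_mul_self _
  have hU' : (hA.eigenvectorUnitary : Matrix N N ℝ) * star (hA.eigenvectorUnitary : Matrix N N ℝ) = 1 :=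
    Unitary.coe_mul_star_self _
  have hV : star (hB.eigenvectorUnitary : Matrix K K ℝ) * (hB.eigenvectorUnitary : Matrix K K ℝ) = 1 :=
    Unitary.coe_star_mul_self _
  have hV' : (hB.eigenvectorUnitary : Matrix K K ℝ) * star (hB.eigenvectorUnitary : Matrix K K ℝ) = 1 :=
    Unitary.coe_mul_star_self _
  have hX2 : matFun (fun t => t) A * X = X * matFun (fun t => t) B := by
    rw [matFun_id_aux hA, matFun_id_aux hB, hX]
  simp only [matFun, dif_pos hA, dif_pos hB] at hX2 ⊢
  generalize (hA.eigenvectorUnitary : Matrix N N ℝ) = U at *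
  generalize (hB.eigenvectorUnitary : Matrix K K ℝ) = V at *
  generalize hA.eigenvalues = a at *
  generalize hB.eigenvalues = b at *
  have e1 : diagonal a * (star U * X * V) = (star U * X * V) * diagonal b := by
    calc _ = (star U * U) * diagonal a * (star U * X * V) := by rw [hU, Matrix.one_mul]
      _ = star U * (U * diagonal a * star U * X) * V := by simp only [Matrix.mul_assoc]
      _ = star U * (X * (V * diagonal b * star V)) * V := by
        congr 2
      _ = (star U * X * V) * diagonal b * (star V * V) := by simp only [Matrix.mul_assoc]
      _ = _ := by rw [hV, Matrix.mul_one]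
  have e2 : diagonal (f ∘ a) * (star U * X * V) = (star U * X * V) * diagonal (f ∘ b) := by
    ext i j
    have := congrFun (congrFun e1 i) j
    rw [diagonal_mul, mul_diagonal] at this ⊢
    rcases eq_or_ne ((star U * X * V) i j) 0 with h0 | h0
    · simp [h0]
    · have : a i = b j := by
        apply mul_right_cancel₀ h0
        rw [this, mul_comm]
      simp [this, mul_comm]
  calc _ = U * (diagonal (f ∘ a) * (star U * X * V)) * star V := by
        conv_lhs => rw [← Matrix.mul_one X, ← hV']
        simp only [Matrix.mul_assoc]
    _ = (U * star U) * X * (V * diagonal (f ∘ b) * star V) := by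
        rw [e2]; simp only [Matrix.mul_assoc]
    _ = _ := by rw [hU', Matrix.one_mul]

/-- If `ψ` is an `r × d` real matrix with `ψψᵀ` invertible and `g : [0,∞) → ℝ` satisfies
`g 0 = 0`, then `g(ψᵀψ) = ψᵀ (ψψᵀ)^{-1/2} g(ψψᵀ) (ψψᵀ)^{-1/2} ψ`. -/
theorem matFun_mul_transpose (r d : ℕ) (ψ : Matrix (Fin r) (Fin d) ℝ)
    (hinv : IsUnit (ψ * ψᵀ)) (g : ℝ → ℝ) (hg0 : g 0 = 0) :
    matFun g (ψᵀ * ψ)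
      = ψᵀ * (matFun (fun t => (Real.sqrt t)⁻¹) (ψ * ψᵀ) * (matFun g (ψ * ψᵀ) *
          (matFun (fun t => (Real.sqrt t)⁻¹) (ψ * ψᵀ) * ψ))) := by
  have hA : (ψᵀ * ψ).PosSemidef := by
    simpa using Matrix.posSemidef_conjTranspose_mul_self ψ
  have hB : (ψ * ψᵀ).PosSemidef := by
    simpa using Matrix.posSemidef_self_mul_conjTranspose ψ
  have h1 : matFun (fun t => (Real.sqrt t)⁻¹) (ψ * ψᵀ) * (matFun g (ψ * ψᵀ) *
      matFun (fun t => (Real.sqrt t)⁻¹) (ψ * ψᵀ)) = matFun (fun t => g t / t) (ψ * ψᵀ) := by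
    rw [matFun_mul_aux _ _ hB.1, matFun_mul_aux _ _ hB.1]
    apply matFun_congr_aux hB
    intro t ht
    conv_rhs => rw [← Real.mul_self_sqrt ht, div_eq_mul_inv, mul_inv, Real.mul_self_sqrt ht]
    ring
  have h2 : matFun g (ψᵀ * ψ) = matFun (fun t => g t / t) (ψᵀ * ψ) * (ψᵀ * ψ) := by
    conv_rhs => arg 2; rw [← matFun_id_aux hA.1]
    rw [matFun_mul_aux _ _ hA.1]
    congr 1
    funext t
    rcases eq_or_ne t 0 with rfl | h
    · simp [hg0]
    · field_simp
  have h3 := matFun_intertwine_aux (fun t => g t / t) hA.1 hB.1 ψᵀ (Matrix.mul_assoc _ _ _)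
  rw [h2, ← Matrix.mul_assoc, h3, ← h1]
  simp only [Matrix.mul_assoc]
end
end

section
/- Let p̂ = (1/n)Σ_{i=1}^n δ_{x_i} be a discrete probability measure on ℝ^d. The first variation of the functional F₁ : p ↦ Tr(Σ_p log Σ_p) at p̂ is given, for x in the support of p̂, by F₁'(p̂)(x) = Tr( φ(x) φ(x)^* (I + log Σ_{p̂}) ): that is, for every perturbation ξ = q − p̂ with q a probability measure with finite second moment supported in the support of p̂, lim_{ε→0} (1/ε)( Tr(Σ_{p̂+εξ} log Σ_{p̂+εξ}) − Tr(Σ_{p̂} log Σ_{p̂}) ) = ∫ Tr( φ(x) φ(x)^* (I + log Σ_{p̂}) ) dξ(x). -/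
open MeasureTheory RealInnerProductSpace Filter
open scoped ENNReal Topology

noncomputable section

/-- The empirical measure `(1/n) ∑ᵢ δ_{x_i}`. -/
def empMeas {d n : ℕ} (xs : Fin n → EuclideanSpace ℝ (Fin d)) :
    Measure (EuclideanSpace ℝ (Fin d)) :=
  (n : ℝ≥0∞)⁻¹ • ∑ i, Measure.dirac (xs i)

/-- `v` is the entropy term `Tr(Σ_μ log Σ_μ)`, expressed through a (finite-rank)
spectral decomposition of the covariance operator of `μ` with positive eigenvalues. -/
def IsEnt {d : ℕ} {H : Type*} [NormedAddCommGroup H] [InnerProductSpace ℝ H]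
    [CompleteSpace H] (φ : EuclideanSpace ℝ (Fin d) → H)
    (μ : Measure (EuclideanSpace ℝ (Fin d))) (v : ℝ) : Prop :=
  ∃ (r : ℕ) (lam : Fin r → ℝ) (f : Fin r → H), Orthonormal ℝ f ∧
    covOp φ μ = ∑ j, lam j • rankOne (f j) (f j) ∧ (∀ j, 0 < lam j) ∧
    v = ∑ j, lam j * Real.log (lam j)

lemma rankOne_app {H : Type*} [NormedAddCommGroup H] [InnerProductSpace ℝ H] (u v w : H) :
    rankOne u v w = ⟪v, w⟫ • u := by
  simp [rankOne]

lemma D_bounds {s t : ℝ} (hs : 0 < s) (ht : 0 < t) :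
    0 ≤ s * Real.log s - s * Real.log t - s + t ∧
    s * Real.log s - s * Real.log t - s + t ≤ s ^ 2 / t - 2 * s + t := by
  have h1 : Real.log (t / s) ≤ t / s - 1 := Real.log_le_sub_one_of_pos (by positivity)
  have h2 : Real.log (s / t) ≤ s / t - 1 := Real.log_le_sub_one_of_pos (by positivity)
  rw [Real.log_div ht.ne' hs.ne'] at h1
  rw [Real.log_div hs.ne' ht.ne'] at h2
  have h1' := mul_le_mul_of_nonneg_left h1 hs.le
  have h2' := mul_le_mul_of_nonneg_left h2 hs.le
  have e1 : s * (t / s - 1) = t - s := by field_simp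
  have e2 : s * (s / t - 1) = s ^ 2 / t - s := by field_simp
  constructor <;> nlinarith

/-- Two-sided Klein inequality. -/
lemma klein {H : Type*} [NormedAddCommGroup H] [InnerProductSpace ℝ H]
    {r m : ℕ} (t : Fin r → ℝ) (f : Fin r → H) (hf : Orthonormal ℝ f) (ht : ∀ j, 0 < t j)
    (s : Fin m → ℝ) (e : Fin m → H) (he : Orthonormal ℝ e) (hs : ∀ i, 0 < s i)
    (X : H →L[ℝ] H) (hX : X = ∑ i, s i • rankOne (e i) (e i))
    (hrange : ∀ v, ∑ j, ⟪f j, X v⟫ • f j = X v) :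
    0 ≤ ∑ i, s i * Real.log (s i) - ∑ j, t j * Real.log (t j)
        - ∑ j, (1 + Real.log (t j)) * (⟪f j, X (f j)⟫ - t j) ∧
    ∑ i, s i * Real.log (s i) - ∑ j, t j * Real.log (t j)
        - ∑ j, (1 + Real.log (t j)) * (⟪f j, X (f j)⟫ - t j)
      ≤ ∑ j, ‖X (f j) - t j • f j‖ ^ 2 / t j := by
  have hXv : ∀ v, X v = ∑ i, (s i * ⟪e i, v⟫) • e i := by
    intro v
    rw [hX]
    simp [rankOne_app, ContinuousLinearMap.sum_apply, smul_smul]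
  set c : Fin m → Fin r → ℝ := fun i j => ⟪e i, f j⟫ ^ 2 with hc
  have hXe : ∀ i, X (e i) = s i • e i := by
    intro i
    rw [hXv]
    rw [Finset.sum_eq_single i]
    · simp [he.1 i]
    · intro b _ hb
      simp [he.2 hb]
    · simp
  have hrow : ∀ i, ∑ j, c i j = 1 := by
    intro i
    have h := hrange (e i)
    rw [hXe] at h
    have h2 := congrArg (fun v => ⟪e i, v⟫) h
    simp only [inner_sum, inner_smul_right, real_inner_self_eq_norm_sq, he.1 i] at h2
    have h3 : s i * ∑ j, c i j = s i * 1 := by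
      rw [Finset.mul_sum]
      rw [show s i * 1 = s i * 1 ^ 2 by ring, ← h2]
      refine Finset.sum_congr rfl fun j _ => ?_
      simp only [hc]
      rw [real_inner_comm (f j) (e i)]
      ring
    exact mul_left_cancel₀ (hs i).ne' h3
  have hcol : ∀ j, ∑ i, c i j ≤ 1 := by
    intro j
    have := he.sum_inner_products_le (x := f j) (s := Finset.univ)
    simpa [hf.1 j, hc] using this
  have hXf : ∀ j, ⟪f j, X (f j)⟫ = ∑ i, c i j * s i := by
    intro j
    rw [hXv, inner_sum]
    refine Finset.sum_congr rfl fun i _ => ?_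
    simp only [hc]
    rw [inner_smul_right, real_inner_comm (e i) (f j)]
    ring
  have hXn : ∀ j, ‖X (f j)‖ ^ 2 = ∑ i, c i j * s i ^ 2 := by
    intro j
    rw [← real_inner_self_eq_norm_sq, hXv, he.inner_sum]
    refine Finset.sum_congr rfl fun i _ => ?_
    simp [hc]
    ring
  have hsub : ∀ j, ‖X (f j) - t j • f j‖ ^ 2 / t j
      = ∑ i, c i j * (s i ^ 2 / t j - 2 * s i) + t j := by
    intro j
    rw [norm_sub_sq_real, hXn, inner_smul_right, real_inner_comm, hXf, norm_smul, hf.1 j]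
    have := (ht j).ne'
    simp only [mul_sub, Finset.sum_sub_distrib, mul_one, Real.norm_eq_abs, sq_abs]
    have e1 : ∑ i, c i j * (s i ^ 2 / t j) = (∑ i, c i j * s i ^ 2) / t j := by
      rw [Finset.sum_div]; refine Finset.sum_congr rfl fun i _ => by ring
    have e2 : ∑ i, c i j * (2 * s i) = 2 * ∑ i, c i j * s i := by
      rw [Finset.mul_sum]; refine Finset.sum_congr rfl fun i _ => by ring
    rw [e1, e2]
    field_simp
  have hmid : ∑ i, s i * Real.log (s i) - ∑ j, t j * Real.log (t j)
        - ∑ j, (1 + Real.log (t j)) * (⟪f j, X (f j)⟫ - t j)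
      = ∑ j, (∑ i, c i j * (s i * Real.log (s i) - s i * Real.log (t j) - s i) + t j) := by
    have e1 : ∑ i, s i * Real.log (s i) = ∑ j, ∑ i, c i j * (s i * Real.log (s i)) := by
      rw [Finset.sum_comm]
      refine Finset.sum_congr rfl fun i _ => ?_
      rw [← Finset.sum_mul, hrow, one_mul]
    rw [e1, ← Finset.sum_sub_distrib, ← Finset.sum_sub_distrib]
    refine Finset.sum_congr rfl fun j _ => ?_
    rw [hXf]
    simp only [mul_sub, Finset.sum_sub_distrib]
    have e2 : ∑ i, c i j * (s i * Real.log (t j)) = Real.log (t j) * ∑ i, c i j * s i := by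
      rw [Finset.mul_sum]; refine Finset.sum_congr rfl fun i _ => by ring
    rw [e2]; ring
  rw [hmid]
  constructor
  · refine Finset.sum_nonneg fun j _ => ?_
    have h1 : ∑ i, c i j * (-(t j))
        ≤ ∑ i, c i j * (s i * Real.log (s i) - s i * Real.log (t j) - s i) := by
      refine Finset.sum_le_sum fun i _ => mul_le_mul_of_nonneg_left ?_ (sq_nonneg _)
      linarith [(D_bounds (hs i) (ht j)).1]
    rw [← Finset.sum_mul] at h1
    nlinarith [hcol j, ht j]
  · refine Finset.sum_le_sum fun j _ => ?_
    rw [hsub]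
    refine add_le_add_left (Finset.sum_le_sum fun i _ =>
      mul_le_mul_of_nonneg_left ?_ (sq_nonneg _)) _
    linarith [(D_bounds (hs i) (ht j)).2]

lemma rankOne_cont {α H : Type*} [TopologicalSpace α] [NormedAddCommGroup H]
    [InnerProductSpace ℝ H] {φ : α → H} (hφ : Continuous φ) :
    Continuous fun y => rankOne (φ y) (φ y) := by
  unfold rankOne
  have : (fun y => (innerSL ℝ (φ y)).smulRight (φ y))
      = fun y => ContinuousLinearMap.smulRightL ℝ H H (innerSL ℝ (φ y)) (φ y) := by
    ext; simp
  rw [this]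
  fun_prop

lemma rankOne_norm_le {H : Type*} [NormedAddCommGroup H]
    [InnerProductSpace ℝ H] (u : H) (hu : ‖u‖ = 1) : ‖rankOne u u‖ ≤ 1 := by
  refine ContinuousLinearMap.opNorm_le_bound _ zero_le_one fun v => ?_
  rw [rankOne_app, norm_smul, hu]
  have := norm_inner_le_norm (𝕜 := ℝ) u v
  rw [hu] at this
  simpa using this

lemma trB_eq {H : Type*} [NormedAddCommGroup H] [InnerProductSpace ℝ H] [CompleteSpace H]
    {ι : Type*} (b : HilbertBasis ι ℝ H) (u : H) (M : H →L[ℝ] H)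
    (hM : ∀ v w, ⟪v, M w⟫ = ⟪M v, w⟫) :
    trB b (rankOne u u ∘L M) = ⟪u, M u⟫ := by
  unfold trB
  simp only [ContinuousLinearMap.comp_apply, rankOne_app, inner_smul_right, hM u]
  rw [b.tsum_inner_mul_inner]

instance empMeas_prob {d n : ℕ} [NeZero n] (xs : Fin n → EuclideanSpace ℝ (Fin d)) :
    IsProbabilityMeasure (empMeas xs) := by
  constructor
  simp [empMeas]
  exact ENNReal.inv_mul_cancel (by simpa using NeZero.ne n) (by simp)

lemma covOp_emp {d n : ℕ} {H : Type*} [NormedAddCommGroup H] [InnerProductSpace ℝ H]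
    [CompleteSpace H] {φ : EuclideanSpace ℝ (Fin d) → H} 
    (x : Fin n → EuclideanSpace ℝ (Fin d)) :
    covOp φ (empMeas x) = (n : ℝ)⁻¹ • ∑ i, rankOne (φ (x i)) (φ (x i)) := by
  unfold covOp empMeas
  rw [integral_smul_measure, integral_finset_sum_measure]
  · simp
  · intro i _
    exact integrable_dirac (by simp)

lemma emp_supp {d n : ℕ} (x : Fin n → EuclideanSpace ℝ (Fin d)) :
    ∀ᵐ y ∂(empMeas x), y ∈ Set.range x := by
  have : MeasurableSet (Set.range x) := (Set.finite_range x).measurableSet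
  rw [ae_iff]
  change empMeas x (Set.range x)ᶜ = 0
  simp [empMeas, Measure.dirac_apply' _ this.compl]

/-- **First variation of the entropy term `F₁ : p ↦ Tr(Σ_p log Σ_p)` at a discrete
measure.**  For `p̂ = (1/n)∑ᵢδ_{x_i}`, every probability measure `q` with finite second
moment supported in the support of `p̂`, and `ξ = q - p̂`,
`lim_{ε→0⁺} (F₁(p̂+εξ) - F₁(p̂))/ε = ∫ Tr(φ(x)φ(x)^*(I + log Σ_{p̂})) dξ(x)`,
where `log Σ_{p̂} = ∑ⱼ log(λⱼ) fⱼfⱼ^*` through the spectral decomposition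
`Σ_{p̂} = ∑ⱼ λⱼ fⱼfⱼ^*`. -/
theorem first_variation_entropy {d n : ℕ} (hn : 0 < n)
    {H : Type*} [NormedAddCommGroup H] [InnerProductSpace ℝ H] [CompleteSpace H]
    {ι : Type*} (b : HilbertBasis ι ℝ H)
    (k : EuclideanSpace ℝ (Fin d) → EuclideanSpace ℝ (Fin d) → ℝ)
    (φ : EuclideanSpace ℝ (Fin d) → H) (hφc : Continuous φ)
    (hk : ∀ x y, k x y = ⟪φ x, φ y⟫) (hk1 : ∀ x, k x x = 1)
    (x : Fin n → EuclideanSpace ℝ (Fin d))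
    -- spectral decomposition of `Σ_{p̂}`:
    (r : ℕ) (lam : Fin r → ℝ) (f : Fin r → H) (hON : Orthonormal ℝ f)
    (hdecomp : covOp φ (empMeas x) = ∑ j, lam j • rankOne (f j) (f j))
    (hpos : ∀ j, 0 < lam j)
    -- the perturbation `ξ = q - p̂`, where `q` has finite second moment and is
    -- supported in the support of `p̂`:
    (q : Measure (EuclideanSpace ℝ (Fin d))) [IsProbabilityMeasure q]
    (hqsupp : q (Set.range x)ᶜ = 0)
    (hq2 : Integrable (fun y => ‖y‖ ^ 2) q)
    -- `Ent` gives the value of `F₁` along the path `ε ↦ p̂ + εξ = (1-ε)p̂ + εq`: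
    (Ent : Measure (EuclideanSpace ℝ (Fin d)) → ℝ)
    (hEnt : ∀ ε ∈ Set.Icc (0 : ℝ) 1,
      IsEnt φ ((1 - ENNReal.ofReal ε) • empMeas x + ENNReal.ofReal ε • q)
        (Ent ((1 - ENNReal.ofReal ε) • empMeas x + ENNReal.ofReal ε • q))) :
    Tendsto
      (fun ε : ℝ =>
        (Ent ((1 - ENNReal.ofReal ε) • empMeas x + ENNReal.ofReal ε • q)
          - Ent (empMeas x)) / ε)
      (𝓝[>] 0)
      (𝓝 ((∫ y, trB b (rankOne (φ y) (φ y) ∘L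
              (1 + ∑ j, Real.log (lam j) • rankOne (f j) (f j))) ∂q)
          - ∫ y, trB b (rankOne (φ y) (φ y) ∘L
              (1 + ∑ j, Real.log (lam j) • rankOne (f j) (f j))) ∂(empMeas x))) := by
  haveI : NeZero n := ⟨hn.ne'⟩
  have hφ1 : ∀ y, ‖φ y‖ = 1 := by
    intro y
    have h := hk1 y
    rw [hk, real_inner_self_eq_norm_sq] at h
    nlinarith [norm_nonneg (φ y)]
  have hint : ∀ (μ : Measure (EuclideanSpace ℝ (Fin d))) [IsFiniteMeasure μ],
      Integrable (fun y => rankOne (φ y) (φ y)) μ := fun μ _ =>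
    Integrable.of_bound (rankOne_cont hφc).aestronglyMeasurable 1
      (Eventually.of_forall fun y => rankOne_norm_le _ (hφ1 y))
  -- `φ (x i)` lies in the span of `f`
  have hspan : ∀ i, ∑ j, ⟪f j, φ (x i)⟫ • f j = φ (x i) := by
    intro i
    set v := φ (x i) - ∑ j, ⟪f j, φ (x i)⟫ • f j with hv
    have hvf : ∀ j, ⟪f j, v⟫ = 0 := by
      intro j
      rw [hv, inner_sub_right, hON.inner_right_fintype, sub_self]
    have hAv : ⟪v, covOp φ (empMeas x) v⟫ = 0 := by
      rw [hdecomp]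
      simp [ContinuousLinearMap.sum_apply, rankOne_app, hvf]
    rw [covOp_emp] at hAv
    have h2 : (n : ℝ)⁻¹ * ∑ l, ⟪φ (x l), v⟫ ^ 2 = 0 := by
      rw [← hAv]
      simp only [ContinuousLinearMap.smul_apply, ContinuousLinearMap.sum_apply, rankOne_app,
        inner_smul_right, inner_sum]
      congr 1
      refine Finset.sum_congr rfl fun l _ => ?_
      rw [real_inner_comm v, sq]
    have h3 : ∑ l, ⟪φ (x l), v⟫ ^ 2 = 0 := by
      have : (n : ℝ)⁻¹ ≠ 0 := by simpa using hn.ne'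
      exact (mul_eq_zero.mp h2).resolve_left this
    have h4 := (Finset.sum_eq_zero_iff_of_nonneg (fun l _ => sq_nonneg _)).mp h3 i
      (Finset.mem_univ i)
    have h5 : ⟪φ (x i), v⟫ = 0 := by simpa using h4
    have h6 : ⟪v, v⟫ = 0 := by
      nth_rewrite 1 [hv]
      rw [inner_sub_left, h5, sum_inner]
      simp [inner_smul_left, hvf]
    have h7 : v = 0 := inner_self_eq_zero.mp h6
    exact (sub_eq_zero.mp h7).symm
  -- projection
  let P : H →L[ℝ] H := ∑ j, rankOne (f j) (f j)
  have hP : ∀ v, P v = ∑ j, ⟪f j, v⟫ • f j := by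
    intro v
    simp [P, ContinuousLinearMap.sum_apply, rankOne_app]
  have hPcov : ∀ (μ : Measure (EuclideanSpace ℝ (Fin d))) [IsFiniteMeasure μ],
      (∀ᵐ y ∂μ, y ∈ Set.range x) → ∀ v, P (covOp φ μ v) = covOp φ μ v := by
    intro μ _ hμ v
    have e : covOp φ μ v = ∫ y, rankOne (φ y) (φ y) v ∂μ :=
      ContinuousLinearMap.integral_apply (hint μ) v
    rw [e, ← ContinuousLinearMap.integral_comp_comm P ((hint μ).apply_continuousLinearMap v)]
    refine integral_congr_ae ?_
    filter_upwards [hμ] with y hy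
    obtain ⟨i, rfl⟩ := hy
    rw [rankOne_app, map_smul, hP, hspan]
  have hqae : ∀ᵐ y ∂q, y ∈ Set.range x := by rw [ae_iff]; exact hqsupp
  -- the linear functional
  let L : (H →L[ℝ] H) →L[ℝ] ℝ := ∑ j, (1 + Real.log (lam j)) •
    ((innerSL ℝ (f j)) ∘L (ContinuousLinearMap.apply ℝ H (f j)))
  have hL : ∀ T, L T = ∑ j, (1 + Real.log (lam j)) * ⟪f j, T (f j)⟫ := by
    intro T
    simp [L, ContinuousLinearMap.sum_apply]
  have hRHS : ∀ (μ : Measure (EuclideanSpace ℝ (Fin d))) [IsFiniteMeasure μ],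
      (∀ᵐ y ∂μ, y ∈ Set.range x) →
      (∫ y, trB b (rankOne (φ y) (φ y) ∘L
              (1 + ∑ j, Real.log (lam j) • rankOne (f j) (f j))) ∂μ) = L (covOp φ μ) := by
    intro μ _ hμ
    unfold covOp
    rw [← ContinuousLinearMap.integral_comp_comm L (hint μ)]
    refine integral_congr_ae ?_
    filter_upwards [hμ] with y hy
    obtain ⟨i, rfl⟩ := hy
    rw [trB_eq, hL]
    · have h1 : ⟪φ (x i), φ (x i)⟫ = ∑ j, ⟪f j, φ (x i)⟫ ^ 2 := by
        nth_rewrite 2 [← hspan i]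
        rw [inner_sum]
        refine Finset.sum_congr rfl fun j _ => ?_
        rw [inner_smul_right, real_inner_comm (f j), sq]
      simp only [ContinuousLinearMap.add_apply, ContinuousLinearMap.one_apply, inner_add_right,
        ContinuousLinearMap.sum_apply, ContinuousLinearMap.smul_apply, rankOne_app, inner_sum,
        inner_smul_right, h1]
      rw [← Finset.sum_add_distrib]
      refine Finset.sum_congr rfl fun j _ => ?_
      rw [real_inner_comm (f j) (φ (x i))]
      ring
    · intro v w
      simp only [ContinuousLinearMap.add_apply, ContinuousLinearMap.one_apply, inner_add_right,
        ContinuousLinearMap.sum_apply, ContinuousLinearMap.smul_apply, rankOne_app, inner_sum,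
        inner_smul_right, inner_add_left, sum_inner, real_inner_smul_left]
      congr 1
      refine Finset.sum_congr rfl fun j _ => ?_
      rw [real_inner_comm (f j) v]
      ring
  rw [hRHS q hqae, hRHS (empMeas x) (emp_supp x)]
  set A := covOp φ (empMeas x) with hA
  set B := covOp φ q with hB
  have hmix : ∀ ε ∈ Set.Icc (0 : ℝ) 1,
      covOp φ ((1 - ENNReal.ofReal ε) • empMeas x + ENNReal.ofReal ε • q)
        = A + ε • (B - A) := by
    intro ε hε
    have h1 : (1 - ENNReal.ofReal ε) = ENNReal.ofReal (1 - ε) := by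
      rw [ENNReal.ofReal_sub _ hε.1, ENNReal.ofReal_one]
    rw [h1]
    unfold covOp
    rw [integral_add_measure ((hint _).smul_measure ENNReal.ofReal_ne_top)
      ((hint _).smul_measure ENNReal.ofReal_ne_top), integral_smul_measure, integral_smul_measure,
      ENNReal.toReal_ofReal hε.1, ENNReal.toReal_ofReal (by linarith [hε.2])]
    change (1 - ε) • A + ε • B = _
    module
  have hAf : ∀ j, A (f j) = lam j • f j := by
    intro j
    rw [hdecomp]
    simp only [ContinuousLinearMap.sum_apply, ContinuousLinearMap.smul_apply, rankOne_app]
    rw [Finset.sum_eq_single j]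
    · simp [hON.1 j]
    · intro l _ hl
      simp [hON.2 hl]
    · simp
  have hLA : L A = ∑ j, (1 + Real.log (lam j)) * lam j := by
    rw [hL]
    refine Finset.sum_congr rfl fun j _ => ?_
    rw [hAf, inner_smul_right, real_inner_self_eq_norm_sq, hON.1 j]
    ring
  set S := ∑ j, lam j * Real.log (lam j) with hS
  set C := ∑ j, ‖(B - A) (f j)‖ ^ 2 / lam j with hC
  have key : ∀ ε ∈ Set.Icc (0 : ℝ) 1,
      0 ≤ Ent ((1 - ENNReal.ofReal ε) • empMeas x + ENNReal.ofReal ε • q) - S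
        - ε * (L B - L A) ∧
      Ent ((1 - ENNReal.ofReal ε) • empMeas x + ENNReal.ofReal ε • q) - S
        - ε * (L B - L A) ≤ ε ^ 2 * C := by
    intro ε hε
    obtain ⟨m, s, e, he, hdec, hs, hval⟩ := hEnt ε hε
    rw [hmix ε hε] at hdec
    have hr : ∀ v, ∑ j, ⟪f j, (A + ε • (B - A)) v⟫ • f j = (A + ε • (B - A)) v := by
      intro v
      rw [← hP]
      have h1 := hPcov (empMeas x) (emp_supp x) v
      have h2 := hPcov q hqae v
      rw [← hA] at h1
      rw [← hB] at h2
      simp only [ContinuousLinearMap.add_apply, ContinuousLinearMap.smul_apply,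
        ContinuousLinearMap.sub_apply, map_add, map_smul, map_sub, h1, h2]
    have hkl := klein lam f hON hpos s e he hs _ hdec hr
    rw [← hval, ← hS] at hkl
    have e1 : ∑ j, (1 + Real.log (lam j)) * (⟪f j, (A + ε • (B - A)) (f j)⟫ - lam j)
        = ε * (L B - L A) := by
      have : L (A + ε • (B - A)) = L A + ε * (L B - L A) := by
        simp only [map_add, map_smul, map_sub, smul_eq_mul]
      simp only [mul_sub, Finset.sum_sub_distrib]
      rw [← hL, this, ← hLA]
      ring
    have e2 : ∑ j, ‖(A + ε • (B - A)) (f j) - lam j • f j‖ ^ 2 / lam j = ε ^ 2 * C := by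
      rw [hC, Finset.mul_sum]
      refine Finset.sum_congr rfl fun j _ => ?_
      rw [ContinuousLinearMap.add_apply, hAf, add_sub_cancel_left,
        ContinuousLinearMap.smul_apply, norm_smul, mul_pow, Real.norm_eq_abs, sq_abs]
      ring
    rw [e1, e2] at hkl
    exact hkl
  have h0 : Ent (empMeas x) = S := by
    have := key 0 (by simp)
    simp at this
    linarith [this.1, this.2]
  rw [h0]
  refine tendsto_of_tendsto_of_tendsto_of_le_of_le' (g := fun _ => L B - L A)
    (h := fun ε => L B - L A + ε * C) tendsto_const_nhds ?_ ?_ ?_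
  · have : Tendsto (fun ε : ℝ => L B - L A + ε * C) (𝓝 0) (𝓝 (L B - L A + 0 * C)) :=
      (Continuous.tendsto (by fun_prop) 0)
    simpa using this.mono_left nhdsWithin_le_nhds
  · filter_upwards [Ioc_mem_nhdsGT (zero_lt_one' ℝ)] with ε hε
    rw [le_div_iff₀ hε.1]
    linarith [(key ε ⟨hε.1.le, hε.2⟩).1]
  · filter_upwards [Ioc_mem_nhdsGT (zero_lt_one' ℝ)] with ε hε
    rw [div_le_iff₀ hε.1]
    nlinarith [(key ε ⟨hε.1.le, hε.2⟩).2]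
end
end

section
/- Let p and q be probability measures on ℝ^d. The function α ↦ KL(p || α p + (1−α) q) is decreasing on [0,1], where KL denotes the Kullback-Leibler divergence. -/
open MeasureTheory
open scoped ENNReal

noncomputable section

open Classical in
/-- The Kullback-Leibler divergence `KL(p‖q) = ∫ log(dp/dq) dp` when `p ≪ q` (with the
log-likelihood ratio `llr p q = log (dp/dq)` integrable), and `+∞` otherwise. -/
def klDiv {α : Type*} [MeasurableSpace α] (p q : Measure α) : EReal :=
  if p ≪ q ∧ Integrable (llr p q) p then ((∫ x, llr p q x ∂p : ℝ) : EReal) else ⊤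

/-- Mixing in `p` decreases the divergence. -/
lemma klDiv_mix_le {X : Type*} [MeasurableSpace X] (p m : Measure X)
    [IsProbabilityMeasure p] [IsProbabilityMeasure m] (t : ℝ) (h0 : 0 ≤ t) (h1 : t ≤ 1) :
    klDiv p (ENNReal.ofReal t • p + ENNReal.ofReal (1 - t) • m) ≤ klDiv p m := by
  by_cases h : p ≪ m ∧ Integrable (llr p m) p
  swap
  · simp [klDiv, h]
  obtain ⟨hpm, hint⟩ := h
  set n := ENNReal.ofReal t • p + ENNReal.ofReal (1 - t) • m with hn
  have : IsFiniteMeasure (ENNReal.ofReal t • p) := Measure.smul_finite _ (by simp)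
  have : IsFiniteMeasure (ENNReal.ofReal (1 - t) • m) := Measure.smul_finite _ (by simp)
  have hnfin : IsFiniteMeasure n := by rw [hn]; infer_instance
  have hpn : p ≪ n := by
    rcases h1.lt_or_eq with h | h
    · refine hpm.trans ?_
      rw [hn, add_comm]
      refine Measure.AbsolutelyContinuous.add_right ?_ _
      exact Measure.absolutelyContinuous_smul (by simpa using h)
    · have : n = p := by simp [hn, h]
      rw [this]
  have hder : n.rnDeriv m =ᵐ[m]
      fun x => ENNReal.ofReal t * p.rnDeriv m x + ENNReal.ofReal (1 - t) := by
    have e1 := Measure.rnDeriv_add' (ENNReal.ofReal t • p) (ENNReal.ofReal (1 - t) • m) m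
    have e2 := Measure.rnDeriv_smul_left_of_ne_top' p m (r := ENNReal.ofReal t) (by simp)
    have e3 := Measure.rnDeriv_smul_left_of_ne_top' m m (r := ENNReal.ofReal (1 - t)) (by simp)
    have e4 := Measure.rnDeriv_self m
    filter_upwards [e1, e2, e3, e4] with x x1 x2 x3 x4
    rw [hn, x1, Pi.add_apply, x2, x3]
    simp [x4]
  have hchain := Measure.rnDeriv_mul_rnDeriv (κ := m) hpn
  have key : ∀ᵐ x ∂p, 0 < (p.rnDeriv m x).toReal ∧ llr p n x = llr p m x -
      Real.log (t * (p.rnDeriv m x).toReal + (1 - t)) := by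
    filter_upwards [hpm.ae_le hder, hpm.ae_le hchain, Measure.rnDeriv_pos hpm,
      Measure.rnDeriv_pos hpn, hpm.ae_le (Measure.rnDeriv_ne_top p m),
      hpn.ae_le (Measure.rnDeriv_ne_top p n)] with x x1 x2 x3' x4' x5 x6
    have x3 := ENNReal.toReal_pos x3'.ne' x5
    have x4 := ENNReal.toReal_pos x4'.ne' x6
    refine ⟨x3, ?_⟩
    have hx : (n.rnDeriv m x).toReal = t * (p.rnDeriv m x).toReal + (1 - t) := by
      rw [x1, ENNReal.toReal_add (ENNReal.mul_ne_top (by simp) x5) (by simp), ENNReal.toReal_mul,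
        ENNReal.toReal_ofReal h0, ENNReal.toReal_ofReal (by linarith)]
    have hm : (p.rnDeriv n x).toReal * (n.rnDeriv m x).toReal = (p.rnDeriv m x).toReal := by
      rw [← x2, Pi.mul_apply, ENNReal.toReal_mul]
    have hne : (n.rnDeriv m x).toReal ≠ 0 := by
      intro h
      rw [h, mul_zero] at hm
      exact x3.ne hm
    rw [← hx, llr, llr, ← hm, Real.log_mul x4.ne' hne]
    ring
  have hint' : Integrable (llr p n) p := by
    refine hint.mono (measurable_llr _ _).aestronglyMeasurable ?_
    filter_upwards [key] with x ⟨hx0, hx⟩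
    rw [hx]
    simp only [llr]
    set f := (p.rnDeriv m x).toReal
    rw [Real.norm_eq_abs, Real.norm_eq_abs]
    rcases le_total 1 f with hf | hf
    · have a1 : 1 ≤ t * f + (1 - t) := by nlinarith
      have a2 : t * f + (1 - t) ≤ f := by nlinarith
      have b1 := Real.log_nonneg a1
      have b2 := Real.log_le_log (by linarith) a2
      rw [abs_of_nonneg (by linarith), abs_of_nonneg (by linarith)]
      linarith
    · have a1 : t * f + (1 - t) ≤ 1 := by nlinarith
      have a2 : f ≤ t * f + (1 - t) := by nlinarith
      have b1 := Real.log_nonpos (by linarith) a1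
      have b2 := Real.log_le_log hx0 a2
      rw [abs_of_nonpos (by linarith), abs_of_nonpos (by linarith)]
      linarith
  have hpos : 0 ≤ ∫ x, llr p m x ∂p := by
    have := InformationTheory.integral_llr_add_sub_measure_univ_nonneg hpm hint
    simpa using this
  have hle : ∫ x, llr p n x ∂p ≤ ∫ x, (1 - t) * llr p m x ∂p := by
    refine integral_mono_ae hint' (hint.const_mul _) ?_
    filter_upwards [key] with x ⟨hx0, hx⟩
    rw [hx]
    simp only [llr]
    set f := (p.rnDeriv m x).toReal
    have := strictConcaveOn_log_Ioi.concaveOn.2 (x := f) (y := 1) hx0 (by simp) h0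
      (by linarith : 0 ≤ 1 - t) (by ring)
    simp only [smul_eq_mul, Real.log_one, mul_zero, mul_one, add_zero] at this
    linarith
  rw [integral_const_mul] at hle
  rw [klDiv, klDiv, if_pos ⟨hpn, hint'⟩, if_pos ⟨hpm, hint⟩, EReal.coe_le_coe_iff]
  nlinarith

/-- The function `α ↦ KL(p ‖ α p + (1-α) q)` is decreasing (nonincreasing) on `[0,1]`. -/
theorem klDiv_skew_antitone {d : ℕ} (p q : Measure (EuclideanSpace ℝ (Fin d)))
    [IsProbabilityMeasure p] [IsProbabilityMeasure q] :
    AntitoneOn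
      (fun α : ℝ => klDiv p (ENNReal.ofReal α • p + ENNReal.ofReal (1 - α) • q))
      (Set.Icc 0 1) := by
  intro a ha b hb hab
  rcases ha.2.lt_or_eq with h | h
  swap
  · have : b = a := le_antisymm (by rw [h]; exact hb.2) hab
    rw [this]
  have hs : 0 < 1 - a := by linarith
  have hb1 := hb.2
  have ha0 := ha.1
  have hP : IsProbabilityMeasure (ENNReal.ofReal a • p + ENNReal.ofReal (1 - a) • q) := by
    constructor
    simp [← ENNReal.ofReal_add ha0 hs.le]
  have ht0 : 0 ≤ (b - a) / (1 - a) := div_nonneg (by linarith) hs.le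
  have ht1 : (b - a) / (1 - a) ≤ 1 := by rw [div_le_one hs]; linarith
  have := klDiv_mix_le p (ENNReal.ofReal a • p + ENNReal.ofReal (1 - a) • q)
    ((b - a) / (1 - a)) ht0 ht1
  have hu : 0 ≤ 1 - (b - a) / (1 - a) := by linarith
  convert this using 2
  rw [smul_add, smul_smul, smul_smul, ← add_assoc, ← add_smul, ← ENNReal.ofReal_mul hu,
    ← ENNReal.ofReal_mul hu, ← ENNReal.ofReal_add ht0 (mul_nonneg hu ha0)]
  congr 3
  · field_simp
    ring
  · field_simp
    ring
end
end
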